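/- Let s ≥ 1 be an integer, let G be an H_s-free graph with clique number ω = ω(G), and let A ⊆ V(G) be such that there is an s-template of G with vertex set contained in A and with value at least 28ω^{s+6}; let 𝓛 = (L_0, L_1, …, L_k) be such an s-template of maximum value. Then: (1) if d ≥ 1 and D ≥ 0 are integers such that every H_s-free graph G' with ω(G') < ω is (ω(G')^d, D)-colourable, and c ≥ 2s satisfies the Kővári–Sós–Turán-type bound for H_s, and ω³ > ω + s/7 and ω ≥ 200, then V(𝓛) ∪ N_A(𝓛) is ((ω−1)^d + ω^{(c+1)(s+7)}, D)-colourable; and (2) if ω ≥ 15 and ω² > s+1, then every vertex in Y_A(𝓛) has at most ω^{s+7} neighbours in A ∖ Y_A(𝓛). -/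

import Mathlib

open SimpleGraph Set

/-- `G` contains no induced subgraph isomorphic to `H`. -/
def IsInducedFree {V : Type*} {W : Type*} (G : SimpleGraph V) (H : SimpleGraph W) : Prop :=
  ∀ s : Set V, ¬ Nonempty ((G.induce s) ≃g H)

/-- The double star `H_s`: two adjacent internal vertices `0` and `1`; `0` is adjacent to the
`s` leaves `2,…,s+1` and `1` is adjacent to the `s` leaves `s+2,…,2s+1`. -/
def doubleStarGraph (s : ℕ) : SimpleGraph (Fin (2*s+2)) :=
  SimpleGraph.fromRel (fun a b =>
    ((a : ℕ) = 0 ∧ (b : ℕ) = 1) ∨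
    ((a : ℕ) = 0 ∧ 2 ≤ (b : ℕ) ∧ (b : ℕ) ≤ s+1) ∨
    ((a : ℕ) = 1 ∧ s+2 ≤ (b : ℕ)))

/-- A graph has degeneracy at most `d` if every nonempty subgraph has a vertex whose degree
in that subgraph is at most `d`. -/
def DegeneracyAtMost {V : Type*} (G : SimpleGraph V) (d : ℕ) : Prop :=
  ∀ H : G.Subgraph, H.verts.Nonempty → ∃ v ∈ H.verts, (H.neighborSet v).ncard ≤ d

/-- A `(k,d)`-colouring: a partition of the vertex set into `k` parts, each inducing a
subgraph of degeneracy at most `d`. -/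
def KDColorable {V : Type*} (G : SimpleGraph V) (k d : ℕ) : Prop :=
  ∃ f : V → Fin k, ∀ i : Fin k, DegeneracyAtMost (G.induce {v | f v = i}) d

/-- `G` contains the complete bipartite graph `K_{t,t}` as a (not necessarily induced)
subgraph. -/
def ContainsKtt {V : Type*} (G : SimpleGraph V) (t : ℕ) : Prop :=
  ∃ A B : Finset V, A.card = t ∧ B.card = t ∧ Disjoint A B ∧
    ∀ a ∈ A, ∀ b ∈ B, G.Adj a b

/-- A set of vertices is stable (independent) if no two of its members are adjacent. -/
def IsStableSet {V : Type*} (G : SimpleGraph V) (S : Set V) : Prop :=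
  ∀ a ∈ S, ∀ b ∈ S, a ≠ b → ¬ G.Adj a b

/-- An `s`-template in `G`: a clique `L0` complete to all the `L i`, pairwise disjoint sets
`L 1, …, L k` (here indexed by `Fin k`) whose sizes lie between `ω^{s+5}` and `14 ω^{s+6}`,
such that each vertex of `L i` has at most `ω^{s+3}` non-neighbours in each other `L j`. -/
def IsTemplate {V : Type*} (G : SimpleGraph V) (s : ℕ) (L0 : Set V) {k : ℕ}
    (L : Fin k → Set V) : Prop :=
  (∀ i : Fin k, Disjoint L0 (L i)) ∧
  (Pairwise fun i j : Fin k => Disjoint (L i) (L j)) ∧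
  G.IsClique L0 ∧
  (∀ u ∈ L0, ∀ i : Fin k, ∀ v ∈ L i, G.Adj u v) ∧
  (∀ i : Fin k, G.cliqueNum ^ (s+5) ≤ (L i).ncard ∧ (L i).ncard ≤ 14 * G.cliqueNum ^ (s+6)) ∧
  (∀ i j : Fin k, i ≠ j → ∀ v ∈ L i,
    ({u ∈ L j | ¬ G.Adj v u}).ncard ≤ G.cliqueNum ^ (s+3))

/-- The value of an `s`-template. -/
noncomputable def templateValue {V : Type*} (G : SimpleGraph V) (s : ℕ) (L0 : Set V) {k : ℕ}
    (L : Fin k → Set V) : ℕ :=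
  (⋃ i, L i).ncard + 7 * G.cliqueNum ^ (s+5) * L0.ncard + k * G.cliqueNum ^ (s+5)

/-- An optimal `s`-template: one of maximum value among all `s`-templates in `G`. -/
def IsOptimalTemplate {V : Type*} (G : SimpleGraph V) (s : ℕ) (L0 : Set V) {k : ℕ}
    (L : Fin k → Set V) : Prop :=
  IsTemplate G s L0 L ∧
  ∀ (k' : ℕ) (L0' : Set V) (L' : Fin k' → Set V), IsTemplate G s L0' L' →
    templateValue G s L0' L' ≤ templateValue G s L0 L

/-- `V(𝓛)`, the vertex set of a template. -/
def templateVerts {V : Type*} (L0 : Set V) {k : ℕ} (L : Fin k → Set V) : Set V :=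
  L0 ∪ ⋃ i, L i

/-- `N(𝓛)`: the vertices outside `V(𝓛)` with a neighbour in `L 1 ∪ ⋯ ∪ L k`. -/
def templateNbhd {V : Type*} (G : SimpleGraph V) (L0 : Set V) {k : ℕ}
    (L : Fin k → Set V) : Set V :=
  {v | v ∉ templateVerts L0 L ∧ ∃ i : Fin k, ∃ u ∈ L i, G.Adj v u}


/-- A vertex `v` is pendant with respect to the template: there are distinct `i, j`, a vertex
`u ∈ L j` and a stable set `S ⊆ L i` of `s+1` common neighbours of `u` such that `v` is not
adjacent to `u` and `v` has exactly one neighbour in `S`. -/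
def TemplatePendant {V : Type*} (G : SimpleGraph V) (s : ℕ) {k : ℕ}
    (L : Fin k → Set V) (v : V) : Prop :=
  ∃ i j : Fin k, i ≠ j ∧ ∃ u ∈ L j, ∃ S : Set V, S ⊆ L i ∧ S.ncard = s + 1 ∧
    IsStableSet G S ∧ (∀ w ∈ S, G.Adj u w) ∧ ¬ G.Adj v u ∧ ({w ∈ S | G.Adj v w}).ncard = 1

/-- A vertex `v` is dense with respect to the template: there are `j` and `u ∈ L j` such that
for all `i ≠ j`, fewer than `ω^{s+2}/14` vertices of `L i` are adjacent to `u` and not to `v`. -/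
def TemplateDense {V : Type*} (G : SimpleGraph V) (s : ℕ) {k : ℕ}
    (L : Fin k → Set V) (v : V) : Prop :=
  ∃ j : Fin k, ∃ u ∈ L j, ∀ i : Fin k, i ≠ j →
    14 * ({w ∈ L i | G.Adj u w ∧ ¬ G.Adj v w}).ncard < G.cliqueNum ^ (s+2)

/-- A vertex `v` is pure with respect to the template: it has no neighbour in at least two of
the sets `L i`, and for each `i`, either it has no neighbour in `L i` or it has at most
`ω^{s+2}/7` non-neighbours in `L i`. -/
def TemplatePure {V : Type*} (G : SimpleGraph V) (s : ℕ) {k : ℕ}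
    (L : Fin k → Set V) (v : V) : Prop :=
  (∃ i₁ i₂ : Fin k, i₁ ≠ i₂ ∧ (∀ w ∈ L i₁, ¬ G.Adj v w) ∧ (∀ w ∈ L i₂, ¬ G.Adj v w)) ∧
  (∀ i : Fin k, (∀ w ∈ L i, ¬ G.Adj v w) ∨
    7 * ({w ∈ L i | ¬ G.Adj v w}).ncard ≤ G.cliqueNum ^ (s+2))

/-- `M_I`: the pure vertices `v` (with respect to the template) whose set `I_v` of indices `i`
such that `v` has a neighbour in `L i` equals `I`. -/
def templatePart {V : Type*} (G : SimpleGraph V) (s : ℕ) (L0 : Set V) {k : ℕ}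
    (L : Fin k → Set V) (I : Set (Fin k)) : Set V :=
  {v | v ∈ templateNbhd G L0 L ∧ TemplatePure G s L v ∧
    ∀ i : Fin k, (∃ u ∈ L i, G.Adj v u) ↔ i ∈ I}

/-- Two disjoint sets `A, B` are `s`-crowded if there is no stable set meeting each of them
in exactly `s` vertices. -/
def SCrowded {V : Type*} (G : SimpleGraph V) (s : ℕ) (A B : Set V) : Prop :=
  ¬ ∃ X : Set V, IsStableSet G X ∧ (X ∩ A).ncard = s ∧ (X ∩ B).ncard = s

/-- `c` satisfies the Kővári–Sós–Turán-type bound for `H_s`: every `H_s`-free graph either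
contains `K_{t,t}` as a subgraph or has degeneracy less than `t^c`. -/
def KSTBound (s c : ℕ) : Prop :=
  ∀ (W : Type) [Fintype W], ∀ G' : SimpleGraph W, IsInducedFree G' (doubleStarGraph s) →
    ∀ t : ℕ, ContainsKtt G' t ∨ ∃ D : ℕ, D < t ^ c ∧ DegeneracyAtMost G' D

/-- `Z(𝓛)`: the union of `L0` with the set of vertices of `N(𝓛)` having at most `ω^{s+2}/4`
non-neighbours in each `L i`. -/
def templateZ {V : Type*} (G : SimpleGraph V) (s : ℕ) (L0 : Set V) {k : ℕ}
    (L : Fin k → Set V) : Set V :=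
  L0 ∪ {v ∈ templateNbhd G L0 L |
    ∀ i : Fin k, 4 * ({u ∈ L i | ¬ G.Adj v u}).ncard ≤ G.cliqueNum ^ (s+2)}

/-- `Y(𝓛) = (V(𝓛) ∪ N(𝓛)) \ Z(𝓛)`. -/
def templateY {V : Type*} (G : SimpleGraph V) (s : ℕ) (L0 : Set V) {k : ℕ}
    (L : Fin k → Set V) : Set V :=
  (templateVerts L0 L ∪ templateNbhd G L0 L) \ templateZ G s L0 L

/-- `N_A(𝓛)`: the vertices of `A \ V(𝓛)` with a neighbour in `L 1 ∪ ⋯ ∪ L k`. -/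
def templateNbhdIn {V : Type*} (G : SimpleGraph V) (A : Set V) (L0 : Set V) {k : ℕ}
    (L : Fin k → Set V) : Set V :=
  {v ∈ A | v ∉ templateVerts L0 L ∧ ∃ i : Fin k, ∃ u ∈ L i, G.Adj v u}

/-- `Z_A(𝓛)`: the union of `L0` with the set of vertices of `A \ V(𝓛)` having at most
`ω^{s+2}/4` non-neighbours in each `L i`. -/
def templateZIn {V : Type*} (G : SimpleGraph V) (s : ℕ) (A : Set V) (L0 : Set V) {k : ℕ}
    (L : Fin k → Set V) : Set V :=
  L0 ∪ {v ∈ A | v ∉ templateVerts L0 L ∧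
    ∀ i : Fin k, 4 * ({u ∈ L i | ¬ G.Adj v u}).ncard ≤ G.cliqueNum ^ (s+2)}

/-- `Y_A(𝓛) = (V(𝓛) ∪ N_A(𝓛)) \ Z_A(𝓛)`. -/
def templateYIn {V : Type*} (G : SimpleGraph V) (s : ℕ) (A : Set V) (L0 : Set V) {k : ℕ}
    (L : Fin k → Set V) : Set V :=
  (templateVerts L0 L ∪ templateNbhdIn G A L0 L) \ templateZIn G s A L0 L

section Aux
open scoped Classical
set_option linter.unusedSectionVars false

variable {V : Type*} [Fintype V]

/-- non-neighbours of `v` in `S` -/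
noncomputable def nn (G : SimpleGraph V) (v : V) (S : Finset V) : Finset V :=
  S.filter (fun u => ¬ G.Adj v u)

/-- stable finsets -/
def St (G : SimpleGraph V) (S : Finset V) : Prop := ∀ a ∈ S, ∀ b ∈ S, ¬ G.Adj a b

/-- cliques -/
def Cl (G : SimpleGraph V) (S : Finset V) : Prop := ∀ a ∈ S, ∀ b ∈ S, a ≠ b → G.Adj a b

/-- no induced double star -/
def NoDS (G : SimpleGraph V) (s : ℕ) : Prop :=
  ∀ (a b : V) (S T : Finset V), G.Adj a b → S.card = s → T.card = s → St G S → St G T →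
    (∀ x ∈ S, ∀ y ∈ T, ¬ G.Adj x y) → (∀ x ∈ S, G.Adj a x) → (∀ y ∈ T, G.Adj b y) →
    (∀ y ∈ T, ¬ G.Adj a y) → (∀ x ∈ S, ¬ G.Adj b x) → b ∉ S → a ∉ T → False

theorem mem_nn {G : SimpleGraph V} {v u : V} {S : Finset V} :
    u ∈ nn G v S ↔ u ∈ S ∧ ¬ G.Adj v u := by simp [nn]

theorem nn_subset {G : SimpleGraph V} {v : V} {S : Finset V} : nn G v S ⊆ S :=
  Finset.filter_subset _ _

theorem nn_mono {G : SimpleGraph V} {v : V} {S T : Finset V} (h : S ⊆ T) :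
    nn G v S ⊆ nn G v T := Finset.filter_subset_filter _ h

theorem noDS_of_free (G : SimpleGraph V) (s : ℕ)
    (h : IsInducedFree G (doubleStarGraph s)) : NoDS G s := by
  intro a b S T hab hS hT sS sT hST haS hbT haT hbS hbS' haT'
  let eS := S.equivFinOfCardEq hS
  let eT := T.equivFinOfCardEq hT
  let f : Fin (2*s+2) → V := fun i =>
    if h0 : (i:ℕ) = 0 then a else if h1 : (i:ℕ) = 1 then b else
    if h2 : (i:ℕ) ≤ s+1 then (eS.symm ⟨i - 2, by omega⟩ : V)
    else (eT.symm ⟨i - (s+2), by omega⟩ : V)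
  have cases : ∀ i : Fin (2*s+2),
      ((i:ℕ) = 0 ∧ f i = a) ∨ ((i:ℕ) = 1 ∧ f i = b) ∨
      ((2 ≤ (i:ℕ) ∧ (i:ℕ) ≤ s+1) ∧ f i ∈ S) ∨
      ((s+2 ≤ (i:ℕ)) ∧ f i ∈ T) := by
    intro i
    by_cases h0 : (i:ℕ) = 0
    · left; exact ⟨h0, dif_pos h0⟩
    by_cases h1 : (i:ℕ) = 1
    · right; left; exact ⟨h1, (dif_neg h0).trans (dif_pos h1)⟩
    by_cases h2 : (i:ℕ) ≤ s+1
    · right; right; left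
      refine ⟨⟨by omega, h2⟩, ?_⟩
      simp only [f, h0, h1, h2, dite_true, dite_false]
      exact Subtype.property _
    · right; right; right
      refine ⟨by omega, ?_⟩
      simp only [f, h0, h1, h2, dite_false]
      exact Subtype.property _
  have haS' : a ∉ S := fun h => (haS a h).ne rfl
  have hbT' : b ∉ T := fun h => (hbT b h).ne rfl
  have hdis : ∀ x, x ∈ S → x ∈ T → False := fun x h1 h2 => haT x h2 (haS x h1)
  have inj : Function.Injective f := by
    intro i j hij
    rcases cases i with ⟨hi, hi'⟩ | ⟨hi, hi'⟩ | ⟨hi, hi'⟩ | ⟨hi, hi'⟩ <;>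
    rcases cases j with ⟨hj, hj'⟩ | ⟨hj, hj'⟩ | ⟨hj, hj'⟩ | ⟨hj, hj'⟩
    · exact Fin.ext (by omega)
    · exact absurd (hi'.symm.trans (hij.trans hj')) hab.ne
    · rw [← hij, hi'] at hj'; exact absurd hj' haS'
    · rw [← hij, hi'] at hj'; exact absurd hj' haT'
    · exact absurd (hj'.symm.trans (hij.symm.trans hi')) hab.ne
    · exact Fin.ext (by omega)
    · rw [← hij, hi'] at hj'; exact absurd hj' hbS'
    · rw [← hij, hi'] at hj'; exact absurd hj' hbT'
    · rw [hij, hj'] at hi'; exact absurd hi' haS'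
    · rw [hij, hj'] at hi'; exact absurd hi' hbS'
    · have e1 : f i = (eS.symm ⟨i - 2, by omega⟩ : V) := by
        simp only [f, hi.2, show ¬ (i:ℕ) = 0 by omega, show ¬ (i:ℕ) = 1 by omega, dite_true,
          dite_false]
      have e2 : f j = (eS.symm ⟨j - 2, by omega⟩ : V) := by
        simp only [f, hj.2, show ¬ (j:ℕ) = 0 by omega, show ¬ (j:ℕ) = 1 by omega, dite_true,
          dite_false]
      rw [e1, e2] at hij
      have := eS.symm.injective (Subtype.ext hij)
      simp only [Fin.mk.injEq] at this
      exact Fin.ext (by omega)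
    · rw [hij] at hi'; exact (hdis _ hi' hj').elim
    · rw [hij, hj'] at hi'; exact absurd hi' haT'
    · rw [hij, hj'] at hi'; exact absurd hi' hbT'
    · rw [hij] at hi'; exact (hdis _ hj' hi').elim
    · have e1 : f i = (eT.symm ⟨i - (s+2), by omega⟩ : V) := by
        simp only [f, show ¬ (i:ℕ) ≤ s+1 by omega, show ¬ (i:ℕ) = 0 by omega,
          show ¬ (i:ℕ) = 1 by omega, dite_false]
      have e2 : f j = (eT.symm ⟨j - (s+2), by omega⟩ : V) := by
        simp only [f, show ¬ (j:ℕ) ≤ s+1 by omega, show ¬ (j:ℕ) = 0 by omega,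
          show ¬ (j:ℕ) = 1 by omega, dite_false]
      rw [e1, e2] at hij
      have := eT.symm.injective (Subtype.ext hij)
      simp only [Fin.mk.injEq] at this
      exact Fin.ext (by omega)
  have adj : ∀ i j : Fin (2*s+2), G.Adj (f i) (f j) ↔ (doubleStarGraph s).Adj i j := by
    intro i j
    simp only [doubleStarGraph, SimpleGraph.fromRel_adj]
    have hne : i ≠ j ↔ (i:ℕ) ≠ (j:ℕ) := by rw [Ne, Fin.ext_iff]
    rw [hne]
    rcases cases i with ⟨hi, hi'⟩ | ⟨hi, hi'⟩ | ⟨hi, hi'⟩ | ⟨hi, hi'⟩ <;>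
    rcases cases j with ⟨hj, hj'⟩ | ⟨hj, hj'⟩ | ⟨hj, hj'⟩ | ⟨hj, hj'⟩
    · rw [hi', hj']; simp only [SimpleGraph.irrefl, false_iff]; omega
    · rw [hi', hj']; simp only [hab, true_iff]; omega
    · rw [hi']; simp only [haS _ hj', true_iff]; omega
    · rw [hi']; simp only [haT _ hj', false_iff]; omega
    · rw [hi', hj']; simp only [hab.symm, true_iff]; omega
    · rw [hi', hj']; simp only [SimpleGraph.irrefl, false_iff]; omega
    · rw [hi']; simp only [hbS _ hj', false_iff]; omega
    · rw [hi']; simp only [hbT _ hj', true_iff]; omega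
    · rw [hj', G.adj_comm]; simp only [haS _ hi', true_iff]; omega
    · rw [hj', G.adj_comm]; simp only [hbS _ hi', false_iff]; omega
    · simp only [sS _ hi' _ hj', false_iff]; omega
    · simp only [hST _ hi' _ hj', false_iff]; omega
    · rw [hj', G.adj_comm]; simp only [haT _ hi', false_iff]; omega
    · rw [hj', G.adj_comm]; simp only [hbT _ hi', true_iff]; omega
    · rw [G.adj_comm]; simp only [hST _ hj' _ hi', false_iff]; omega
    · simp only [sT _ hi' _ hj', false_iff]; omega
  let e : doubleStarGraph s ↪g G := ⟨⟨f, inj⟩, fun {i j} => adj i j⟩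
  exact h (Set.range e) ⟨e.isoInduceRange.symm⟩

/-- Ramsey-type bound -/
theorem ramsey_aux (G : SimpleGraph V) (w : ℕ) (hw : 2 ≤ w)
    (cl : ∀ C : Finset V, Cl G C → C.card ≤ w) :
    ∀ (n : ℕ) (X : Finset V), w ^ n ≤ X.card + 1 → ∃ T ⊆ X, T.card = n ∧ St G T := by
  intro n
  induction n with
  | zero => intro X _; exact ⟨∅, by simp, by simp, by simp [St]⟩
  | succ n ih =>
    intro X hX
    obtain ⟨C, hC, hmax⟩ := Finset.exists_max_image
      (X.powerset.filter (fun C => Cl G C)) Finset.card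
      ⟨∅, Finset.mem_filter.2 ⟨by simp, by simp [Cl]⟩⟩
    simp only [Finset.mem_filter, Finset.mem_powerset] at hC hmax
    have hcov : X ⊆ C.biUnion (fun v => nn G v X) := by
      intro u hu
      by_contra hcon
      simp only [Finset.mem_biUnion, mem_nn, not_exists, not_and, not_not] at hcon
      have huC : u ∉ C := fun h => (hcon u h hu).ne rfl
      have := hmax (insert u C) ⟨Finset.insert_subset hu hC.1, by
        intro a ha b hb hne
        rw [Finset.mem_insert] at ha hb
        rcases ha with rfl | ha <;> rcases hb with rfl | hb
        · exact absurd rfl hne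
        · exact (hcon b hb hu).symm
        · exact hcon a ha hu
        · exact hC.2 a ha b hb hne⟩
      rw [Finset.card_insert_of_notMem huC] at this
      omega
    have hex : ∃ v ∈ C, w ^ n ≤ (nn G v X).card := by
      by_contra hcon
      push Not at hcon
      have h1 : X.card ≤ C.card * (w ^ n - 1) :=
        (Finset.card_le_card hcov).trans
          (Finset.card_biUnion_le_card_mul _ _ _ (fun v hv => by have := hcon v hv; omega))
      have h2 : C.card * (w ^ n - 1) ≤ w * (w ^ n - 1) := Nat.mul_le_mul_right _ (cl C hC.2)
      have h3 : w * (w ^ n - 1) = w ^ (n+1) - w := by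
        rw [Nat.mul_sub, pow_succ]; ring_nf
      have h4 : w ≤ w ^ (n+1) := Nat.le_self_pow (by omega) _
      omega
    obtain ⟨v, hv, hvn⟩ := hex
    have hvX : v ∈ nn G v X := mem_nn.2 ⟨hC.1 hv, G.irrefl⟩
    obtain ⟨T, hT, hTc, hTs⟩ := ih ((nn G v X).erase v) (by
      rw [Finset.card_erase_of_mem hvX]; omega)
    have hvT : v ∉ T := fun h => (Finset.mem_erase.1 (hT h)).1 rfl
    have hTX : ∀ x ∈ T, x ∈ X ∧ ¬ G.Adj v x := fun x hx => mem_nn.1 (Finset.mem_erase.1 (hT hx)).2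
    refine ⟨insert v T, ?_, ?_, ?_⟩
    · intro x hx
      rcases Finset.mem_insert.1 hx with rfl | hx
      · exact hC.1 hv
      · exact (hTX x hx).1
    · rw [Finset.card_insert_of_notMem hvT, hTc]
    · intro a ha b hb
      rcases Finset.mem_insert.1 ha with ha1 | ha1 <;>
        rcases Finset.mem_insert.1 hb with hb1 | hb1
      · rw [ha1, hb1]; exact G.irrefl
      · rw [ha1]; exact (hTX b hb1).2
      · rw [hb1, G.adj_comm]; exact (hTX a ha1).2
      · exact hTs a ha1 b hb1

theorem ramsey (G : SimpleGraph V) (w : ℕ) (hw : 2 ≤ w)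
    (cl : ∀ C : Finset V, Cl G C → C.card ≤ w) (n : ℕ) (X : Finset V) (h : w ^ n ≤ X.card) :
    ∃ T ⊆ X, T.card = n ∧ St G T :=
  ramsey_aux G w hw cl n X (by omega)

theorem sum_nn (G : SimpleGraph V) (X Y : Finset V) :
    ∑ x ∈ X, (nn G x Y).card = ∑ y ∈ Y, (nn G y X).card := by
  have := Finset.sum_card_bipartiteAbove_eq_sum_card_bipartiteBelow
    (s := X) (t := Y) (fun a b => ¬ G.Adj a b)
  simp only [Finset.bipartiteAbove, Finset.bipartiteBelow] at this
  simp only [nn]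
  rw [this]
  refine Finset.sum_congr rfl fun y _ => ?_
  congr 1
  ext x
  simp [G.adj_comm]

/-- number of vertices of `L` with more than `q` non-neighbours in `B`. -/
theorem bad_count (G : SimpleGraph V) (B L : Finset V) (c m q : ℕ)
    (h : ∀ b ∈ B, c * (nn G b L).card ≤ m) :
    c * (L.filter (fun x => q < (nn G x B).card)).card * q ≤ B.card * m := by
  set X := L.filter (fun x => q < (nn G x B).card)
  have h1 : X.card * q ≤ ∑ x ∈ X, (nn G x B).card := by
    rw [← smul_eq_mul]
    exact Finset.card_nsmul_le_sum _ _ _ (fun x hx => (Finset.mem_filter.1 hx).2.le)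
  have h2 : c * ∑ b ∈ B, (nn G b X).card ≤ B.card * m := by
    rw [Finset.mul_sum, ← smul_eq_mul]
    exact Finset.sum_le_card_nsmul _ _ _ (fun b hb =>
      (Nat.mul_le_mul_left _ (Finset.card_le_card (nn_mono (Finset.filter_subset _ _)))).trans
        (h b hb))
  rw [← sum_nn] at h2
  calc c * X.card * q = c * (X.card * q) := by ring
    _ ≤ _ := (Nat.mul_le_mul_left _ h1).trans h2

/-! ### degeneracy -/

/-- degeneracy at most `d` on the finset `X` -/
def Dg (G : SimpleGraph V) (X : Finset V) (d : ℕ) : Prop :=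
  ∀ S ⊆ X, S.Nonempty → ∃ v ∈ S, (S.filter (fun u => G.Adj v u)).card ≤ d

/-- `(n,d)`-colourability of a finset -/
def KD (G : SimpleGraph V) (X : Finset V) (n d : ℕ) : Prop :=
  ∃ f : V → ℕ, (∀ v ∈ X, f v < n) ∧ ∀ i, Dg G (X.filter (fun v => f v = i)) d

theorem Dg.mono {G : SimpleGraph V} {X Y : Finset V} {d : ℕ} (h : Dg G Y d) (hX : X ⊆ Y) :
    Dg G X d := fun S hS hne => h S (hS.trans hX) hne

theorem Dg.of_stable {G : SimpleGraph V} {X : Finset V} {d : ℕ} (h : St G X) : Dg G X d := by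
  intro S hS ⟨v, hv⟩
  refine ⟨v, hv, ?_⟩
  rw [Finset.filter_false_of_mem (fun u hu => h v (hS hv) u (hS hu))]
  simp

theorem KD.mono {G : SimpleGraph V} {X Y : Finset V} {n m d : ℕ} (h : KD G Y n d) (hX : X ⊆ Y)
    (hn : n ≤ m) : KD G X m d := by
  obtain ⟨f, h1, h2⟩ := h
  exact ⟨f, fun v hv => (h1 v (hX hv)).trans_le hn, fun i =>
    (h2 i).mono (Finset.filter_subset_filter _ hX)⟩

theorem KD.union {G : SimpleGraph V} {X Y : Finset V} {n m d : ℕ} (h : KD G X n d)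
    (h' : KD G Y m d) : KD G (X ∪ Y) (n + m) d := by
  obtain ⟨f, h1, h2⟩ := h
  obtain ⟨g, h3, h4⟩ := h'
  refine ⟨fun v => if v ∈ X then f v else n + g v, ?_, ?_⟩
  · intro v hv
    by_cases hX : v ∈ X
    · simp only [hX, if_true]; have := h1 v hX; omega
    · have hY : v ∈ Y := (Finset.mem_union.1 hv).resolve_left hX
      simp only [hX, if_false]; have := h3 v hY; omega
  · intro i
    by_cases hi : i < n
    · refine (h2 i).mono ?_
      intro v hv
      simp only [Finset.mem_filter] at hv ⊢
      by_cases hX : v ∈ X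
      · simp only [hX, if_true] at hv; exact ⟨hX, hv.2⟩
      · simp only [hX, if_false] at hv; omega
    · refine (h4 (i - n)).mono ?_
      intro v hv
      simp only [Finset.mem_filter] at hv ⊢
      by_cases hX : v ∈ X
      · simp only [hX, if_true] at hv; have := h1 v hX; omega
      · simp only [hX, if_false] at hv
        exact ⟨(Finset.mem_union.1 hv.1).resolve_left hX, by omega⟩

theorem KD.empty {G : SimpleGraph V} {d : ℕ} : KD G ∅ 0 d :=
  ⟨fun _ => 0, by simp, fun i => by intro S hS ⟨v, hv⟩; simpa using hS hv⟩

theorem KD.biUnion {G : SimpleGraph V} {β : Type*} {n d : ℕ} (J : Finset β) (X : β → Finset V)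
    (h : ∀ j ∈ J, KD G (X j) n d) : KD G (J.biUnion X) (J.card * n) d := by
  induction J using Finset.induction_on with
  | empty => simpa using KD.empty
  | insert j J hj ih =>
    rw [Finset.biUnion_insert, Finset.card_insert_of_notMem hj]
    refine ((h j (Finset.mem_insert_self _ _)).union
      (ih (fun i hi => h i (Finset.mem_insert_of_mem hi)))).mono (Finset.Subset.refl _) ?_
    ring_nf; rfl

theorem KD.of_card {G : SimpleGraph V} (d : ℕ) (X : Finset V) : KD G X X.card d := by
  let e := X.equivFin
  refine ⟨fun v => if h : v ∈ X then (e ⟨v, h⟩ : ℕ) else 0, ?_, ?_⟩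
  · intro v hv
    simp only [hv, dite_true]
    exact (e ⟨v, hv⟩).2
  · intro i
    refine Dg.of_stable ?_
    intro a ha b hb hab
    simp only [Finset.mem_filter] at ha hb
    obtain ⟨ha, ha'⟩ := ha
    obtain ⟨hb, hb'⟩ := hb
    simp only [ha, hb, dite_true] at ha' hb'
    have := e.injective (Fin.ext (ha'.trans hb'.symm))
    simp only [Subtype.mk.injEq] at this
    exact hab.ne this

theorem KD.of_Dg_aux {G : SimpleGraph V} {e : ℕ} (n : ℕ) : ∀ (X : Finset V), X.card = n →
    Dg G X e → ∃ f : V → ℕ, (∀ v ∈ X, f v < e + 1) ∧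
      ∀ a ∈ X, ∀ b ∈ X, G.Adj a b → f a ≠ f b := by
  induction n with
  | zero =>
    intro X hX _
    rw [Finset.card_eq_zero] at hX
    subst hX
    exact ⟨fun _ => 0, by simp, by simp⟩
  | succ n ih =>
    intro X hX hd
    obtain ⟨v, hv, hvd⟩ := hd X (Finset.Subset.refl _) (Finset.card_pos.1 (by omega))
    obtain ⟨f, hf1, hf2⟩ := ih (X.erase v) (by rw [Finset.card_erase_of_mem hv]; omega)
      (hd.mono (Finset.erase_subset _ _))
    have : ∃ c ∈ Finset.range (e+1), c ∉ (X.filter (fun u => G.Adj v u)).image f := by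
      by_contra hcon
      push Not at hcon
      have h1 := Finset.card_le_card (show Finset.range (e+1) ⊆ _ from hcon)
      have h2 := Finset.card_image_le (s := X.filter (fun u => G.Adj v u)) (f := f)
      rw [Finset.card_range] at h1
      omega
    obtain ⟨c, hc, hc'⟩ := this
    refine ⟨fun x => if x = v then c else f x, ?_, ?_⟩
    · intro x hx
      by_cases hxv : x = v
      · simp only [hxv, if_true]; exact Finset.mem_range.1 hc
      · simp only [hxv, if_false]; exact hf1 x (Finset.mem_erase.2 ⟨hxv, hx⟩)
    · intro a ha b hb hab
      by_cases hav : a = v <;> by_cases hbv : b = v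
      · exact absurd (hav.trans hbv.symm) hab.ne
      · simp only [hav, hbv, if_true, if_false]
        rintro rfl
        exact hc' (Finset.mem_image.2 ⟨b, Finset.mem_filter.2 ⟨hb, hav ▸ hab⟩, rfl⟩)
      · simp only [hav, hbv, if_true, if_false]
        rintro rfl
        exact hc' (Finset.mem_image.2 ⟨a, Finset.mem_filter.2 ⟨ha, hbv ▸ hab.symm⟩, rfl⟩)
      · simp only [hav, hbv, if_false]
        exact hf2 a (Finset.mem_erase.2 ⟨hav, ha⟩) b (Finset.mem_erase.2 ⟨hbv, hb⟩) hab

theorem KD.of_Dg {G : SimpleGraph V} {X : Finset V} {e : ℕ} (d : ℕ) (h : Dg G X e) :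
    KD G X (e + 1) d := by
  obtain ⟨f, h1, h2⟩ := KD.of_Dg_aux _ X rfl h
  refine ⟨f, h1, fun i => Dg.of_stable ?_⟩
  intro a ha b hb hab
  simp only [Finset.mem_filter] at ha hb
  exact h2 a ha.1 b hb.1 hab (ha.2.trans hb.2.symm)

end Aux

section Aux
open scoped Classical
set_option linter.unusedSectionVars false

variable {V : Type*} [Fintype V]

/-- finset templates -/
structure Tpl (G : SimpleGraph V) (w s : ℕ) {ι : Type} (L0 : Finset V) (L : ι → Finset V) :
    Prop where
  cl0 : Cl G L0
  com : ∀ u ∈ L0, ∀ i, ∀ v ∈ L i, G.Adj u v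
  dj : ∀ i j, i ≠ j → Disjoint (L i) (L j)
  lo : ∀ i, w ^ (s+5) ≤ (L i).card
  hi : ∀ i, (L i).card ≤ 14 * w ^ (s+6)
  few : ∀ i j, i ≠ j → ∀ v ∈ L i, (nn G v (L j)).card ≤ w ^ (s+3)

/-- value of a finset template -/
def tval (w s : ℕ) {ι : Type} [Fintype ι] (L0 : Finset V) (L : ι → Finset V) : ℕ :=
  ∑ i, (L i).card + 7 * w ^ (s+5) * L0.card + Fintype.card ι * w ^ (s+5)

/-- the standing context -/
structure Ctx (G : SimpleGraph V) (w s : ℕ) {ι : Type} [Fintype ι] (A L0 : Finset V)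
    (L : ι → Finset V) : Prop where
  hs : 1 ≤ s
  hw : 15 ≤ w
  cl : ∀ C : Finset V, Cl G C → C.card ≤ w
  ds : NoDS G s
  T : Tpl G w s L0 L
  L0A : L0 ⊆ A
  LA : ∀ i, L i ⊆ A
  opt : ∀ (κ : Type) [Fintype κ] (K : Finset V) (M : κ → Finset V), Tpl G w s K M → K ⊆ A →
    (∀ i, M i ⊆ A) → tval w s K M ≤ tval w s L0 L
  hval : 28 * w ^ (s+6) ≤ tval w s L0 L

theorem pw15 {w : ℕ} (hw : 15 ≤ w) (n : ℕ) : 15 * w ^ n ≤ w ^ (n+1) := by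
  rw [pow_succ, mul_comm]; exact Nat.mul_le_mul_left _ hw

theorem pwpos {w : ℕ} (hw : 15 ≤ w) (n : ℕ) : 0 < w ^ n := Nat.pow_pos (by omega)

theorem nn_compl_card (G : SimpleGraph V) (v : V) (S : Finset V) :
    (nn G v S).card + (S.filter (fun u => G.Adj v u)).card = S.card := by
  unfold nn
  rw [add_comm]
  exact Finset.card_filter_add_card_filter_not _

section
variable {G : SimpleGraph V} {w s : ℕ} {ι : Type} {L0 : Finset V} {L : ι → Finset V}

theorem Tpl.sub (T : Tpl G w s L0 L) {κ : Type} (σ : κ → ι) (hσ : Function.Injective σ)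
    (M : κ → Finset V) (hM : ∀ i, M i ⊆ L (σ i)) (hlo : ∀ i, w ^ (s+5) ≤ (M i).card)
    (K : Finset V) (hK : Cl G K) (hcom : ∀ u ∈ K, ∀ i, ∀ v ∈ M i, G.Adj u v) :
    Tpl G w s K M where
  cl0 := hK
  com := hcom
  dj := fun i j hij => (T.dj _ _ (hσ.ne hij)).mono (hM i) (hM j)
  lo := hlo
  hi := fun i => (Finset.card_le_card (hM i)).trans (T.hi _)
  few := fun i j hij v hv => (Finset.card_le_card (nn_mono (hM j))).trans
    (T.few _ _ (hσ.ne hij) v (hM i hv))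

theorem Tpl.ext (T : Tpl G w s L0 L) {β : Type} (B : β → Finset V)
    (hcom : ∀ u ∈ L0, ∀ i, ∀ v ∈ B i, G.Adj u v)
    (hdj : ∀ i j, i ≠ j → Disjoint (B i) (B j))
    (hdj' : ∀ i j, Disjoint (L i) (B j))
    (hlo : ∀ i, w ^ (s+5) ≤ (B i).card) (hhi : ∀ i, (B i).card ≤ 14 * w ^ (s+6))
    (hfew : ∀ i j, i ≠ j → ∀ v ∈ B i, (nn G v (B j)).card ≤ w ^ (s+3))
    (hfew1 : ∀ i j, ∀ v ∈ L i, (nn G v (B j)).card ≤ w ^ (s+3))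
    (hfew2 : ∀ i j, ∀ v ∈ B j, (nn G v (L i)).card ≤ w ^ (s+3)) :
    Tpl G w s L0 (Sum.elim L B) where
  cl0 := T.cl0
  com := by
    rintro u hu (i | i) v hv
    · exact T.com u hu i v hv
    · exact hcom u hu i v hv
  dj := by
    rintro (i | i) (j | j) hij
    · exact T.dj i j (fun h => hij (by rw [h]))
    · exact hdj' i j
    · exact (hdj' j i).symm
    · exact hdj i j (fun h => hij (by rw [h]))
  lo := by
    rintro (i | i)
    · exact T.lo i
    · exact hlo i
  hi := by
    rintro (i | i)
    · exact T.hi i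
    · exact hhi i
  few := by
    rintro (i | i) (j | j) hij v hv
    · exact T.few i j (fun h => hij (by rw [h])) v hv
    · exact hfew1 i j v hv
    · exact hfew2 j i v hv
    · exact hfew i j (fun h => hij (by rw [h])) v hv

theorem tval_ext [Fintype ι] {β : Type} [Fintype β] (B : β → Finset V) :
    tval w s L0 (Sum.elim L B) = tval w s L0 L + ∑ b, (B b).card + Fintype.card β * w ^ (s+5) := by
  simp only [tval, Fintype.sum_sum_type, Sum.elim_inl, Sum.elim_inr, Fintype.card_sum]
  ring

theorem Tpl.notL0 (T : Tpl G w s L0 L) {i : ι} {v : V} (hv : v ∈ L i) : v ∉ L0 :=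
  fun h => (T.com v h i v hv).ne rfl

theorem Tpl.idx (T : Tpl G w s L0 L) {i j : ι} {v : V} (hv : v ∈ L i) (hv' : v ∈ L j) :
    i = j := by
  by_contra h
  exact Finset.disjoint_left.1 (T.dj i j h) hv hv'

theorem Tpl.greedy (T : Tpl G w s L0 L) (hw : 15 ≤ w)
    (cl : ∀ C : Finset V, Cl G C → C.card ≤ w)
    (K : Finset V) (hK : Cl G K) (J : Finset ι) :
    (∀ v ∈ K, ∀ j ∈ J, (nn G v (L j)).card ≤ w ^ (s+3)) →
    ∃ K', Cl G K' ∧ K ⊆ K' ∧ K'.card = K.card + J.card ∧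
      ∀ x ∈ K', x ∈ K ∨ ∃ j ∈ J, x ∈ L j := by
  induction J using Finset.induction_on with
  | empty => intro _; exact ⟨K, hK, Finset.Subset.refl _, by simp, fun x hx => Or.inl hx⟩
  | insert j J hj ih =>
    intro h
    obtain ⟨K', h1, h2, h3, h4⟩ := ih (fun v hv i hi => h v hv i (Finset.mem_insert_of_mem hi))
    have h5 : ∀ v ∈ K', (nn G v (L j)).card ≤ w ^ (s+3) := by
      intro v hv
      rcases h4 v hv with hv' | ⟨i, hi, hv'⟩
      · exact h v hv' j (Finset.mem_insert_self _ _)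
      · exact T.few i j (fun e => hj (e ▸ hi)) v hv'
    have h6 : (K'.biUnion (fun v => nn G v (L j))).card < (L j).card := by
      have e1 := Finset.card_biUnion_le_card_mul _ _ _ h5
      have e2 : K'.card * w ^ (s+3) ≤ w * w ^ (s+3) := Nat.mul_le_mul_right _ (cl _ h1)
      have e3 : w * w ^ (s+3) = w ^ (s+4) := by ring
      have e4 := pw15 hw (s+4)
      have e5 := T.lo j
      have e6 := pwpos hw (s+4)
      simp only [add_assoc, Nat.reduceAdd] at *
      omega
    obtain ⟨x, hx, hx'⟩ := Finset.exists_mem_notMem_of_card_lt_card h6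
    have hadj : ∀ v ∈ K', G.Adj v x := by
      intro v hv
      by_contra hn
      exact hx' (Finset.mem_biUnion.2 ⟨v, hv, mem_nn.2 ⟨hx, hn⟩⟩)
    have hxK : x ∉ K' := fun h => (hadj x h).ne rfl
    refine ⟨insert x K', ?_, h2.trans (Finset.subset_insert _ _), ?_, ?_⟩
    · intro a ha b hb hab
      rcases Finset.mem_insert.1 ha with ha | ha <;> rcases Finset.mem_insert.1 hb with hb | hb
      · exact absurd (ha.trans hb.symm) hab
      · rw [ha]; exact (hadj b hb).symm
      · rw [hb]; exact hadj a ha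
      · exact h1 a ha b hb hab
    · rw [Finset.card_insert_of_notMem hxK, Finset.card_insert_of_notMem hj, h3]; ring
    · intro y hy
      rcases Finset.mem_insert.1 hy with hy | hy
      · right; exact ⟨j, Finset.mem_insert_self _ _, hy ▸ hx⟩
      · rcases h4 y hy with h | ⟨i, hi, h⟩
        · exact Or.inl h
        · exact Or.inr ⟨i, Finset.mem_insert_of_mem hi, h⟩

end

namespace Ctx
variable {G : SimpleGraph V} {w s : ℕ} {ι : Type} [Fintype ι] {A L0 : Finset V} {L : ι → Finset V}

theorem nnL0 (H : Ctx G w s A L0 L) {v : V} (hv : v ∈ L0) (i : ι) : (nn G v (L i)).card = 0 := by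
  rw [Finset.card_eq_zero, Finset.eq_empty_iff_forall_notMem]
  intro x hx
  exact (mem_nn.1 hx).2 (H.T.com v hv i x (mem_nn.1 hx).1)

theorem T1 (H : Ctx G w s A L0 L) : L0.card + Fintype.card ι ≤ w := by
  obtain ⟨K, h1, h2, h3, h4⟩ := H.T.greedy H.hw H.cl L0 H.T.cl0 Finset.univ
    (fun v hv j _ => by rw [H.nnL0 hv]; exact Nat.zero_le _)
  have := H.cl K h1
  rwa [h3, Finset.card_univ] at this

theorem T1' (H : Ctx G w s A L0 L) (n : ℕ) :
    L0.card * w ^ n + Fintype.card ι * w ^ n ≤ w ^ (n+1) := by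
  rw [← add_mul, pow_succ, mul_comm (w ^ n)]
  exact Nat.mul_le_mul_right _ H.T1

theorem T6 (H : Ctx G w s A L0 L) : 2 ≤ Fintype.card ι := by
  have h1 := H.hval
  unfold tval at h1
  have h2 : ∑ i, (L i).card ≤ Fintype.card ι * (14 * w ^ (s+6)) := by
    rw [← smul_eq_mul, ← Finset.card_univ]
    exact Finset.sum_le_card_nsmul _ _ _ (fun i _ => H.T.hi i)
  have h3 := H.T1' (s+5)
  have h4 := pwpos H.hw (s+6)
  by_contra hk
  have hk : Fintype.card ι ≤ 1 := by omega
  have h5 : Fintype.card ι * (14 * w ^ (s+6)) ≤ 14 * w ^ (s+6) := by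
    calc _ ≤ 1 * (14 * w ^ (s+6)) := Nat.mul_le_mul_right _ hk
      _ = _ := one_mul _
  simp only [add_assoc, Nat.reduceAdd] at *
  have e : 7 * w ^ (s+5) * L0.card = 7 * (L0.card * w ^ (s+5)) := by ring
  omega

theorem T2 (H : Ctx G w s A L0 L) (j : ι) : 5 * w ^ (s+5) ≤ (L j).card := by
  by_contra hcon
  set J : Finset ι := Finset.univ.filter (fun j => (L j).card < 5 * w ^ (s+5)) with hJ
  have hJpos : 0 < J.card := Finset.card_pos.2 ⟨j, by simp [hJ]; omega⟩
  obtain ⟨K, h1, h2, h3, h4⟩ := H.T.greedy H.hw H.cl L0 H.T.cl0 J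
    (fun v hv j _ => by rw [H.nnL0 hv]; exact Nat.zero_le _)
  let M : {i // i ∉ J} → Finset V := fun i => (L i).filter (fun x => ∀ v ∈ K, G.Adj v x)
  have hloss : ∀ i : {i // i ∉ J}, (L i).card ≤ (M i).card + J.card * w ^ (s+3) := by
    intro i
    have : L i ⊆ M i ∪ (K \ L0).biUnion (fun v => nn G v (L i)) := by
      intro x hx
      by_cases hxM : x ∈ M i
      · exact Finset.mem_union_left _ hxM
      · apply Finset.mem_union_right
        have : ¬ ∀ v ∈ K, G.Adj v x := fun h => hxM (Finset.mem_filter.2 ⟨hx, h⟩)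
        push Not at this
        obtain ⟨v, hv, hvx⟩ := this
        refine Finset.mem_biUnion.2 ⟨v, Finset.mem_sdiff.2 ⟨hv, fun h => hvx ?_⟩, mem_nn.2 ⟨hx, hvx⟩⟩
        exact H.T.com v h i x hx
    refine (Finset.card_le_card this).trans ((Finset.card_union_le _ _).trans ?_)
    gcongr
    have e : (K \ L0).card = J.card := by
      rw [Finset.card_sdiff_of_subset h2, h3]; omega
    rw [← e]
    apply Finset.card_biUnion_le_card_mul
    intro v hv
    obtain ⟨hv1, hv2⟩ := Finset.mem_sdiff.1 hv
    rcases h4 v hv1 with h | ⟨j', hj', h⟩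
    · exact absurd h hv2
    · exact H.T.few j' i (fun e => i.2 (e ▸ hj')) v h
  have hJk : J.card ≤ Fintype.card ι := Finset.card_le_univ _
  have hJw : J.card ≤ w := by have := H.T1; omega
  have e1 : J.card * w ^ (s+3) ≤ w ^ (s+4) := by
    calc _ ≤ w * w ^ (s+3) := Nat.mul_le_mul_right _ hJw
      _ = _ := by ring
  have p4 := pw15 H.hw (s+4)
  have p4' := pwpos H.hw (s+4)
  have hTM : Tpl G w s K M := by
    refine H.T.sub Subtype.val Subtype.val_injective M (fun i => Finset.filter_subset _ _) ?_ K h1 ?_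
    · intro i
      have a1 : ¬ (L i).card < 5 * w ^ (s+5) := by
        have := i.2; simpa [hJ] using this
      have a2 := hloss i
      simp only [add_assoc, Nat.reduceAdd] at *
      omega
    · intro u hu i v hv
      exact (Finset.mem_filter.1 hv).2 u hu
  have hopt := H.opt _ K M hTM (by
    intro x hx
    rcases h4 x hx with h | ⟨j, _, h⟩
    · exact H.L0A h
    · exact H.LA j h) (fun i x hx => H.LA i (Finset.mem_filter.1 hx).1)
  unfold tval at hopt
  have c1 : Fintype.card {i // i ∉ J} + J.card = Fintype.card ι := by
    rw [Fintype.card_subtype_compl, Fintype.card_coe]; omega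
  have c2 : ∑ i, (L i).card = ∑ i ∈ J, (L i).card + ∑ i : {i // i ∉ J}, (L i).card := by
    rw [← Finset.sum_subtype (Finset.univ.filter (· ∉ J)) (by simp) (fun i => (L i).card),
      ← Finset.sum_filter_add_sum_filter_not Finset.univ (· ∈ J)]
    congr 1
    apply Finset.sum_congr _ (fun _ _ => rfl)
    ext; simp
  have c3 : ∑ i ∈ J, (L i).card ≤ J.card * (5 * w ^ (s+5)) := by
    rw [← smul_eq_mul]
    refine Finset.sum_le_card_nsmul _ _ _ (fun i hi => ?_)
    exact (Finset.mem_filter.1 hi).2.le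
  have c4 : ∑ i : {i // i ∉ J}, (L i).card ≤
      ∑ i : {i // i ∉ J}, (M i).card + J.card * w ^ (s+4) := by
    calc _ ≤ ∑ i : {i // i ∉ J}, ((M i).card + J.card * w ^ (s+3)) :=
          Finset.sum_le_sum (fun i _ => hloss i)
      _ = ∑ i : {i // i ∉ J}, (M i).card + Fintype.card {i // i ∉ J} * (J.card * w ^ (s+3)) := by
          rw [Finset.sum_add_distrib, Finset.sum_const, smul_eq_mul, Finset.card_univ]
      _ ≤ ∑ i : {i // i ∉ J}, (M i).card + w * (J.card * w ^ (s+3)) := by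
          gcongr
          have := H.T1; omega
      _ = _ := by ring
  have c5 : 15 * (J.card * w ^ (s+4)) ≤ J.card * w ^ (s+5) := by
    calc _ = J.card * (15 * w ^ (s+4)) := by ring
      _ ≤ _ := Nat.mul_le_mul_left _ p4
  have c6 : 0 < J.card * w ^ (s+4) := Nat.mul_pos hJpos p4'
  rw [h3, c2, ← c1] at hopt
  have e2 : 7 * w ^ (s+5) * (L0.card + J.card) = 7 * w ^ (s+5) * L0.card + 7 * (J.card * w ^ (s+5)) := by
    ring
  have e3 : (Fintype.card {i // i ∉ J} + J.card) * w ^ (s+5) =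
    Fintype.card {i // i ∉ J} * w ^ (s+5) + J.card * w ^ (s+5) := by ring
  have e4 : J.card * (5 * w ^ (s+5)) = 5 * (J.card * w ^ (s+5)) := by ring
  rw [e2, e3] at hopt
  rw [e4] at c3
  omega

theorem T3 (H : Ctx G w s A L0 L) {i : ι} {v : V} (hv : v ∈ L i) :
    3 * w ^ (s+5) ≤ (nn G v (L i)).card := by
  by_contra hcon
  push Not at hcon
  have hvL0 := H.T.notL0 hv
  let M : ι → Finset V := fun j => (L j).filter (fun x => G.Adj v x)
  have hM : ∀ j, (nn G v (L j)).card + (M j).card = (L j).card := fun j => nn_compl_card G v (L j)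
  have hfew : ∀ j, j ≠ i → (nn G v (L j)).card ≤ w ^ (s+3) := fun j hj => H.T.few i j hj.symm v hv
  have p3 := pw15 H.hw (s+3)
  have p4 := pw15 H.hw (s+4)
  have p4' := pwpos H.hw (s+3)
  simp only [add_assoc, Nat.reduceAdd] at p3 p4
  have hTM : Tpl G w s (insert v L0) M := by
    refine H.T.sub id Function.injective_id M (fun i => Finset.filter_subset _ _) ?_ _ ?_ ?_
    · intro j
      have a1 := H.T2 j
      have a2 := hM j
      by_cases hj : j = i
      · subst hj; omega
      · have := hfew j hj; omega
    · intro a ha b hb hab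
      rcases Finset.mem_insert.1 ha with ha | ha <;> rcases Finset.mem_insert.1 hb with hb | hb
      · exact absurd (ha.trans hb.symm) hab
      · rw [ha]; exact (H.T.com b hb i v hv).symm
      · rw [hb]; exact H.T.com a ha i v hv
      · exact H.T.cl0 a ha b hb hab
    · intro u hu j x hx
      rcases Finset.mem_insert.1 hu with rfl | hu
      · exact (Finset.mem_filter.1 hx).2
      · exact H.T.com u hu j x (Finset.mem_filter.1 hx).1
  have hopt := H.opt _ _ M hTM (Finset.insert_subset (H.LA i hv) H.L0A)
    (fun i x hx => H.LA i (Finset.mem_filter.1 hx).1)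
  unfold tval at hopt
  rw [Finset.card_insert_of_notMem hvL0] at hopt
  have c2 : ∑ j, (L j).card ≤ ∑ j, (M j).card + 3 * w ^ (s+5) + w ^ (s+4) := by
    have : ∑ j, (L j).card = ∑ j, (nn G v (L j)).card + ∑ j, (M j).card := by
      rw [← Finset.sum_add_distrib]; exact Finset.sum_congr rfl (fun j _ => (hM j).symm)
    rw [this, ← Finset.add_sum_erase _ _ (Finset.mem_univ i)]
    have h1 : ∑ j ∈ Finset.univ.erase i, (nn G v (L j)).card ≤
        (Finset.univ.erase i).card * w ^ (s+3) := by
      rw [← smul_eq_mul]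
      exact Finset.sum_le_card_nsmul _ _ _ (fun j hj => hfew j (Finset.mem_erase.1 hj).1)
    have h2 : (Finset.univ.erase i).card * w ^ (s+3) ≤ w * w ^ (s+3) := by
      gcongr
      have := H.T1
      have := Finset.card_erase_le (a := i) (s := (Finset.univ : Finset ι))
      rw [Finset.card_univ] at this
      omega
    have h3 : w * w ^ (s+3) = w ^ (s+4) := by ring
    omega
  have e1 : 7 * w ^ (s+5) * (L0.card + 1) = 7 * w ^ (s+5) * L0.card + 7 * w ^ (s+5) := by ring
  omega

theorem T4 (H : Ctx G w s A L0 L) (B : Finset V) (hBA : B ⊆ A) (hBL : ∀ i, Disjoint (L i) B)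
    (hB : ∀ b ∈ B, ∀ i, 4 * (nn G b (L i)).card ≤ w ^ (s+2)) : B.card < 14 * w ^ (s+6) := by
  by_contra hcon
  push Not at hcon
  obtain ⟨B', hB'B, hB'c⟩ := Finset.exists_subset_card_eq hcon
  let M : ι → Finset V := fun i => (L i).filter (fun x => ¬ w ^ (s+3) < (nn G x B').card)
  have hbad : ∀ i, 4 * ((L i).filter (fun x => w ^ (s+3) < (nn G x B').card)).card ≤
      14 * w ^ (s+5) := by
    intro i
    have := bad_count G B' (L i) 4 (w ^ (s+2)) (w ^ (s+3)) (fun b hb => hB b (hB'B hb) i)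
    rw [hB'c] at this
    have e : 14 * w ^ (s+6) * w ^ (s+2) = 14 * w ^ (s+5) * w ^ (s+3) := by ring
    rw [e] at this
    exact Nat.le_of_mul_le_mul_right this (pwpos H.hw _)
  have hsum : ∀ i, ((L i).filter (fun x => w ^ (s+3) < (nn G x B').card)).card + (M i).card =
      (L i).card := fun i => Finset.card_filter_add_card_filter_not _
  have p2 := pw15 H.hw (s+2)
  have p5 := pw15 H.hw (s+5)
  have p5' := pwpos H.hw (s+5)
  simp only [add_assoc, Nat.reduceAdd] at p2 p5
  have hTM : Tpl G w s ∅ M := by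
    refine H.T.sub id Function.injective_id M (fun i => Finset.filter_subset _ _) ?_ _ ?_ ?_
    · intro i
      have := hbad i
      have := hsum i
      have := H.T2 i
      omega
    · simp [Cl]
    · simp
  have hTM' : Tpl G w s ∅ (Sum.elim M (fun _ : Unit => B')) := by
    refine hTM.ext _ (by simp) ?_ ?_ ?_ ?_ ?_ ?_ ?_
    · intro i j hij; exact absurd (Subsingleton.elim i j) hij
    · intro i _; exact (hBL i).mono (Finset.filter_subset _ _) hB'B
    · intro _; omega
    · intro _; exact hB'c.le
    · intro i j hij; exact absurd (Subsingleton.elim i j) hij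
    · intro i _ v hv; exact not_lt.1 (Finset.mem_filter.1 hv).2
    · intro i _ v hv
      have := hB v (hB'B hv) i
      have h2 := Finset.card_le_card (nn_mono (G := G) (v := v) (Finset.filter_subset
        (fun x => ¬ w ^ (s+3) < (nn G x B').card) (L i)))
      change (nn G v (M i)).card ≤ _ at h2
      omega
  have hopt := H.opt _ _ _ hTM' (by simp) (by
    rintro (i | i)
    · exact (Finset.filter_subset _ _).trans (H.LA i)
    · exact hB'B.trans hBA)
  rw [tval_ext] at hopt
  unfold tval at hopt
  simp only [Finset.card_empty, mul_zero, add_zero, Finset.univ_unique, Finset.sum_const,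
    Finset.card_singleton, one_smul, Fintype.card_unit, one_mul, hB'c] at hopt
  have c1 : 4 * ∑ i, (L i).card ≤ 4 * ∑ i, (M i).card + Fintype.card ι * (14 * w ^ (s+5)) := by
    rw [Finset.mul_sum, Finset.mul_sum, ← Finset.card_univ, ← smul_eq_mul, ← Finset.sum_const,
      ← Finset.sum_add_distrib]
    refine Finset.sum_le_sum (fun i _ => ?_)
    have := hbad i
    have := hsum i
    omega
  have c2 := H.T1' (s+5)
  have e1 : 7 * w ^ (s+5) * L0.card = 7 * (L0.card * w ^ (s+5)) := by ring
  have e2 : Fintype.card ι * (14 * w ^ (s+5)) = 14 * (Fintype.card ι * w ^ (s+5)) := by ring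
  rw [e1] at hopt
  rw [e2] at c1
  simp only [add_assoc, Nat.reduceAdd] at *
  omega

theorem T5 (H : Ctx G w s A L0 L) {j : ι} {u : V} (hu : u ∈ L j) (B : Bool → Finset V)
    (hBA : ∀ b, B b ⊆ A) (hBL : ∀ b i, Disjoint (L i) (B b)) (hBc : ∀ b, (B b).card = 14 * w ^ (s+6))
    (hBd : Disjoint (B true) (B false))
    (hBB : ∀ x ∈ B true, ∀ y ∈ B false, G.Adj x y)
    (hB : ∀ b, ∀ v ∈ B b, ∀ i, i ≠ j →
      14 * (nn G v ((L i).filter (fun x => G.Adj u x))).card ≤ w ^ (s+2)) : False := by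
  let N : ι → Finset V := fun i => (L i).filter (fun x => G.Adj u x)
  let bd : Bool → ι → Finset V := fun b i => (N i).filter (fun x => w ^ (s+3) < (nn G x (B b)).card)
  let M : {i // i ≠ j} → Finset V := fun i => (N i) \ (bd true i ∪ bd false i)
  have hbad : ∀ b, ∀ i, i ≠ j → (bd b i).card ≤ w ^ (s+5) := by
    intro b i hij
    have := bad_count G (B b) (N i) 14 (w ^ (s+2)) (w ^ (s+3)) (fun v hv => hB b v hv i hij)
    rw [hBc] at this
    have e : 14 * w ^ (s+6) * w ^ (s+2) = 14 * w ^ (s+5) * w ^ (s+3) := by ring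
    rw [e] at this
    have := Nat.le_of_mul_le_mul_right this (pwpos H.hw _)
    change 14 * (bd b i).card ≤ _ at this
    omega
  have hsum : ∀ i : {i // i ≠ j}, (L i).card ≤ (M i).card + 2 * w ^ (s+5) + w ^ (s+3) := by
    intro i
    have h1 : (N i).card ≤ (M i).card + (bd true i ∪ bd false i).card := by
      have := Finset.card_le_card_sdiff_add_card (s := N i) (t := bd true i ∪ bd false i)
      exact this
    have h2 := Finset.card_union_le (bd true i) (bd false i)
    have h3 := hbad true i i.2
    have h4 := hbad false i i.2
    have h5 := nn_compl_card G u (L i)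
    have h6 := H.T.few j i i.2.symm u hu
    change _ + (N i).card = _ at h5
    omega
  have p2 := pw15 H.hw (s+2)
  have p3 := pw15 H.hw (s+3)
  have p4 := pw15 H.hw (s+4)
  have p5 := pw15 H.hw (s+5)
  have p5' := pwpos H.hw (s+2)
  simp only [add_assoc, Nat.reduceAdd] at p2 p3 p4 p5
  have hMN : ∀ i, M i ⊆ N i := fun i => Finset.sdiff_subset
  have hML : ∀ i, M i ⊆ L i := fun i => (hMN i).trans (Finset.filter_subset _ _)
  have hTM : Tpl G w s ∅ M := by
    refine H.T.sub Subtype.val Subtype.val_injective M hML ?_ _ ?_ ?_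
    · intro i
      have := hsum i
      have := H.T2 i
      omega
    · simp [Cl]
    · simp
  have hTM' : Tpl G w s ∅ (Sum.elim M B) := by
    refine hTM.ext _ (by simp) ?_ ?_ ?_ ?_ ?_ ?_ ?_
    · rintro (_ | _) (_ | _) hij
      · exact absurd rfl hij
      · exact hBd.symm
      · exact hBd
      · exact absurd rfl hij
    · intro i b; exact (hBL b i).mono (hML i) (Finset.Subset.refl _)
    · intro b; rw [hBc]; omega
    · intro b; exact (hBc b).le
    · rintro (_ | _) (_ | _) hij v hv
      · exact absurd rfl hij
      · rw [show nn G v (B true) = ∅ from Finset.filter_eq_empty_iff.2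
          (fun x hx => not_not.2 (hBB x hx v hv).symm)]
        simp
      · rw [show nn G v (B false) = ∅ from Finset.filter_eq_empty_iff.2
          (fun x hx => not_not.2 (hBB v hv x hx))]
        simp
      · exact absurd rfl hij
    · intro i b v hv
      have h1 := (Finset.mem_sdiff.1 hv)
      by_contra hcon
      apply h1.2
      cases b
      · exact Finset.mem_union_right _ (Finset.mem_filter.2 ⟨h1.1, not_le.1 hcon⟩)
      · exact Finset.mem_union_left _ (Finset.mem_filter.2 ⟨h1.1, not_le.1 hcon⟩)
    · intro i b v hv
      have h1 := hB b v hv i i.2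
      have h2 := Finset.card_le_card (nn_mono (G := G) (v := v) (hMN i))
      change _ ≤ (nn G v ((L i).filter (fun x => G.Adj u x))).card at h2
      omega
  have hopt := H.opt _ _ _ hTM' (by simp) (by
    rintro (i | i)
    · exact (hML i).trans (H.LA i)
    · exact hBA i)
  rw [tval_ext] at hopt
  unfold tval at hopt
  simp only [Finset.card_empty, mul_zero, add_zero, Fintype.card_bool, Fintype.sum_bool,
    hBc] at hopt
  have c0 : Fintype.card {i // i ≠ j} + 1 = Fintype.card ι := by
    have h2 : 0 < Fintype.card ι := Fintype.card_pos_iff.2 ⟨j⟩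
    have : Fintype.card {i // i ≠ j} = Fintype.card ι - 1 := by
      simp [Fintype.card_subtype_compl]
    omega
  have c1 : ∑ i, (L i).card ≤ (L j).card + (∑ i : {i // i ≠ j}, (M i).card +
      Fintype.card {i // i ≠ j} * (2 * w ^ (s+5) + w ^ (s+3))) := by
    rw [← Finset.add_sum_erase _ _ (Finset.mem_univ j)]
    gcongr
    rw [Finset.sum_subtype (Finset.univ.erase j) (p := fun i => i ≠ j) (by simp) (fun i => (L i).card),
      ← Finset.card_univ, ← smul_eq_mul, ← Finset.sum_const,
      ← Finset.sum_add_distrib]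
    refine Finset.sum_le_sum (fun i _ => ?_)
    have := hsum i
    omega
  have c2 := H.T1' (s+5)
  rw [← c0] at c2 hopt
  have c3 := H.T.hi j
  have e1 : 7 * w ^ (s+5) * L0.card = 7 * (L0.card * w ^ (s+5)) := by ring
  have e2 : Fintype.card {i // i ≠ j} * (2 * w ^ (s+5) + w ^ (s+3)) ≤
      3 * (Fintype.card {i // i ≠ j} * w ^ (s+5)) := by
    calc _ ≤ Fintype.card {i // i ≠ j} * (3 * w ^ (s+5)) := by
          apply Nat.mul_le_mul_left; omega
      _ = _ := by ring
  rw [e1, add_mul] at hopt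
  rw [add_mul] at c2
  simp only [add_assoc, Nat.reduceAdd] at *
  omega

end Ctx
end Aux

section Aux
open scoped Classical
set_option linter.unusedSectionVars false

variable {V : Type*} [Fintype V]

namespace Ctx
variable {G : SimpleGraph V} {w s : ℕ} {ι : Type} [Fintype ι] {A L0 : Finset V} {L : ι → Finset V}

theorem exists_ne (H : Ctx G w s A L0 L) (j : ι) : ∃ i, i ≠ j := by
  have : Nontrivial ι := Fintype.one_lt_card_iff_nontrivial.1 (by have := H.T6; omega)
  exact _root_.exists_ne j

theorem far (H : Ctx G w s A L0 L) {v : V} (hvL : ∀ i, v ∉ L i)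
    (hv : ∃ i, ∃ u ∈ L i, G.Adj v u) (hj : ∃ j, w ^ (s+2) < 4 * (nn G v (L j)).card)
    (F : Finset V) (hF1 : ∀ u ∈ F, G.Adj v u) (hF2 : ∀ u ∈ F, ∀ i, u ∉ L i)
    (hF3 : ∀ u ∈ F, ∀ i, ∀ x ∈ L i, ¬ G.Adj u x) : F.card < w ^ s := by
  by_contra hcon
  push Not at hcon
  have hw := H.hw
  obtain ⟨T, hTF, hTc, hTs⟩ := ramsey G w (by omega) H.cl s F hcon
  have claim : ∀ i y, y ∈ L i → G.Adj v y → ∀ j, j ≠ i →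
      ((L j).filter (fun x => G.Adj y x ∧ ¬ G.Adj v x)).card < w ^ s := by
    intro i y hy hvy j hji
    by_contra hcon
    push Not at hcon
    obtain ⟨S, hSF, hSc, hSs⟩ := ramsey G w (by omega) H.cl s _ hcon
    have hS : ∀ x ∈ S, x ∈ L j ∧ G.Adj y x ∧ ¬ G.Adj v x := fun x hx => Finset.mem_filter.1 (hSF hx)
    refine H.ds v y T S hvy hTc hSc hTs hSs ?_ ?_ ?_ ?_ ?_ ?_ ?_
    · intro x hx y hy; exact hF3 x (hTF hx) j y (hS y hy).1
    · intro x hx; exact hF1 x (hTF hx)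
    · intro x hx; exact (hS x hx).2.1
    · intro x hx; exact (hS x hx).2.2
    · intro x hx; rw [G.adj_comm]; exact hF3 x (hTF hx) i y hy
    · intro h; exact hF2 y (hTF h) i hy
    · intro h; exact hvL j (hS v h).1
  have claim2 : ∀ i y, y ∈ L i → G.Adj v y → ∀ j, j ≠ i →
      (nn G v (L j)).card < w ^ s + w ^ (s+3) := by
    intro i y hy hvy j hji
    have h1 := claim i y hy hvy j hji
    have h2 := H.T.few i j hji.symm y hy
    have h3 : nn G v (L j) ⊆ (L j).filter (fun x => G.Adj y x ∧ ¬ G.Adj v x) ∪ nn G y (L j) := by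
      intro x hx
      rw [mem_nn] at hx
      by_cases hyx : G.Adj y x
      · exact Finset.mem_union_left _ (Finset.mem_filter.2 ⟨hx.1, hyx, hx.2⟩)
      · exact Finset.mem_union_right _ (mem_nn.2 ⟨hx.1, hyx⟩)
    have h4 := (Finset.card_le_card h3).trans (Finset.card_union_le _ _)
    omega
  have p0 := pw15 H.hw s
  have p1 := pw15 H.hw (s+1)
  have p2 := pw15 H.hw (s+2)
  have p3 := pw15 H.hw (s+3)
  have p4 := pw15 H.hw (s+4)
  have pp := pwpos H.hw s
  simp only [add_assoc, Nat.reduceAdd] at p0 p1 p2 p3 p4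
  have big : ∀ j, (nn G v (L j)).card < w ^ s + w ^ (s+3) →
      4 * w ^ (s+5) ≤ ((L j).filter (fun x => G.Adj v x)).card := by
    intro j hj
    have h1 := nn_compl_card G v (L j)
    have h2 := H.T2 j
    omega
  obtain ⟨i0, y0, hy0, hvy0⟩ := hv
  have all : ∀ j, (nn G v (L j)).card < w ^ s + w ^ (s+3) := by
    intro j
    by_cases hji : j = i0
    · obtain ⟨i, hi⟩ := H.exists_ne i0
      have h1 := big i (claim2 i0 y0 hy0 hvy0 i hi)
      obtain ⟨y, hy⟩ := Finset.card_pos.1 (show 0 < _ by omega : 0 < ((L i).filter (fun x => G.Adj v x)).card)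
      rw [Finset.mem_filter] at hy
      exact claim2 i y hy.1 hy.2 j (by rw [hji]; exact hi.symm)
    · exact claim2 i0 y0 hy0 hvy0 j hji
  obtain ⟨j, hj⟩ := hj
  obtain ⟨i, hij⟩ := H.exists_ne j
  set Y := (L i).filter (fun x => G.Adj v x) with hY
  set X := nn G v (L j) with hX
  have hYc : 4 * w ^ (s+5) ≤ Y.card := big i (all i)
  have h1 : Y.card * X.card ≤ ∑ y ∈ Y, (nn G y X).card + Y.card * w ^ s := by
    rw [← smul_eq_mul, ← smul_eq_mul, ← Finset.sum_const, ← Finset.sum_const,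
      ← Finset.sum_add_distrib]
    refine Finset.sum_le_sum (fun y hy => ?_)
    rw [Finset.mem_filter] at hy
    have e1 := claim i y hy.1 hy.2 j hij.symm
    have e2 := nn_compl_card G y X
    have e3 : X.filter (fun u => G.Adj y u) ⊆ (L j).filter (fun x => G.Adj y x ∧ ¬ G.Adj v x) := by
      intro x hx
      rw [Finset.mem_filter, mem_nn] at hx
      exact Finset.mem_filter.2 ⟨hx.1.1, hx.2, hx.1.2⟩
    have e4 := Finset.card_le_card e3
    omega
  have h2 : ∑ y ∈ Y, (nn G y X).card ≤ X.card * w ^ (s+3) := by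
    rw [← sum_nn, ← smul_eq_mul]
    refine Finset.sum_le_card_nsmul _ _ _ (fun x hx => ?_)
    rw [mem_nn] at hx
    exact (Finset.card_le_card (nn_mono (Finset.filter_subset _ _))).trans
      (H.T.few j i hij.symm x hx.1)
  have h3 : 4 * (Y.card * w ^ s) ≤ Y.card * X.card := by
    calc _ = Y.card * (4 * w ^ s) := by ring
      _ ≤ _ := Nat.mul_le_mul_left _ (by omega)
  have h4 : 4 * (X.card * w ^ (s+3)) ≤ Y.card * X.card := by
    calc _ = (4 * w ^ (s+3)) * X.card := by ring
      _ ≤ _ := Nat.mul_le_mul_right _ (by omega)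
  have h5 : 0 < Y.card * X.card := Nat.mul_pos (by omega) (by omega)
  omega

theorem part2 (H : Ctx G w s A L0 L) {v : V}
    (hv : (∃ i, v ∈ L i) ∨ ((∀ i, v ∉ L i) ∧ (∃ i, ∃ u ∈ L i, G.Adj v u) ∧
      ∃ j, w ^ (s+2) < 4 * (nn G v (L j)).card))
    (X : Finset V) (hXv : ∀ u ∈ X, G.Adj v u)
    (hX : ∀ u ∈ X, u ∈ L0 ∨ (u ∈ A ∧ (∀ i, u ∉ L i) ∧ ∀ i, 4 * (nn G u (L i)).card ≤ w ^ (s+2)) ∨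
      ((∀ i, ∀ x ∈ L i, ¬ G.Adj u x) ∧ ∀ i, u ∉ L i)) : X.card ≤ w ^ (s+7) := by
  set Z := A.filter (fun u => (∀ i, u ∉ L i) ∧ ∀ i, 4 * (nn G u (L i)).card ≤ w ^ (s+2))
  set F := X.filter (fun u => (∀ i, ∀ x ∈ L i, ¬ G.Adj u x) ∧ ∀ i, u ∉ L i)
  have hsub : X ⊆ L0 ∪ (Z ∪ F) := by
    intro u hu
    rcases hX u hu with h | ⟨h1, h2⟩ | h
    · exact Finset.mem_union_left _ h
    · exact Finset.mem_union_right _ (Finset.mem_union_left _ (Finset.mem_filter.2 ⟨h1, h2⟩))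
    · exact Finset.mem_union_right _ (Finset.mem_union_right _ (Finset.mem_filter.2 ⟨hu, h⟩))
  have hc := (Finset.card_le_card hsub).trans ((Finset.card_union_le _ _).trans
    (Nat.add_le_add_left (Finset.card_union_le _ _) _))
  have hZ : Z.card < 14 * w ^ (s+6) := by
    refine H.T4 Z (Finset.filter_subset _ _) ?_ ?_
    · intro i
      rw [Finset.disjoint_right]
      intro u hu
      exact (Finset.mem_filter.1 hu).2.1 i
    · intro b hb; exact (Finset.mem_filter.1 hb).2.2
  have hFc : F.card ≤ w ^ s := by
    rcases hv with ⟨i, hi⟩ | ⟨h1, h2, h3⟩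
    · have : F = ∅ := by
        rw [Finset.eq_empty_iff_forall_notMem]
        intro u hu
        rw [Finset.mem_filter] at hu
        exact hu.2.1 i v hi (hXv u hu.1).symm
      simp [this]
    · refine (H.far h1 h2 h3 F ?_ ?_ ?_).le
      · intro u hu; exact hXv u (Finset.mem_filter.1 hu).1
      · intro u hu; exact (Finset.mem_filter.1 hu).2.2
      · intro u hu; exact (Finset.mem_filter.1 hu).2.1
  have h1 := H.T1
  have p0 := pw15 H.hw s
  have p1 := pw15 H.hw (s+1)
  have p2 := pw15 H.hw (s+2)
  have p3 := pw15 H.hw (s+3)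
  have p4 := pw15 H.hw (s+4)
  have p5 := pw15 H.hw (s+5)
  have p6 := pw15 H.hw (s+6)
  have pp := pwpos H.hw s
  have p7 : w ≤ w ^ (s+1) := Nat.le_self_pow (by omega) _
  simp only [add_assoc, Nat.reduceAdd] at p0 p1 p2 p3 p4 p5 p6
  omega

end Ctx
end Aux

section Aux
open scoped Classical
set_option linter.unusedSectionVars false

variable {V : Type*} [Fintype V]

/-- pendant vertices -/
def Pend (G : SimpleGraph V) (s : ℕ) {ι : Type} (L : ι → Finset V) (v : V) : Prop :=
  ∃ i j, i ≠ j ∧ ∃ u ∈ L j, ∃ y ∈ L i, ∃ S ⊆ L i, S.card = s ∧ St G S ∧ ¬ G.Adj v u ∧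
    G.Adj v y ∧ (∀ x ∈ S, ¬ G.Adj v x) ∧ G.Adj u y ∧ (∀ x ∈ S, G.Adj u x) ∧
    (∀ x ∈ S, ¬ G.Adj y x)

namespace Ctx
variable {G : SimpleGraph V} {w s : ℕ} {ι : Type} [Fintype ι] {A L0 : Finset V} {L : ι → Finset V}

theorem star (H : Ctx G w s A L0 L) (hw : 200 ≤ w) {v : V} (hv : ¬ Pend G s L v) {i j : ι}
    (hij : i ≠ j) {u : V} (hu : u ∈ L j) (huv : ¬ G.Adj v u) :
    (∀ y ∈ L i, G.Adj u y → ¬ G.Adj v y) ∨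
    14 * ((L i).filter (fun x => G.Adj u x ∧ ¬ G.Adj v x)).card < w ^ (s+2) := by
  by_contra hcon
  push Not at hcon
  obtain ⟨⟨y0, hy0, huy0, hvy0⟩, hX0⟩ := hcon
  set X := (L i).filter (fun x => G.Adj u x ∧ ¬ G.Adj v x) with hX
  set W := (L i).filter (fun x => G.Adj u x ∧ G.Adj v x) with hW
  have hXL : X ⊆ L i := Finset.filter_subset _ _
  have hWL : W ⊆ L i := Finset.filter_subset _ _
  have few : ∀ z ∈ W, (nn G z X).card < w ^ s := by
    intro z hz
    by_contra hcon
    push Not at hcon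
    obtain ⟨S, hS, hSc, hSs⟩ := ramsey G w (by omega) H.cl s _ hcon
    rw [Finset.mem_filter] at hz
    have hS' : ∀ x ∈ S, (x ∈ L i ∧ G.Adj u x ∧ ¬ G.Adj v x) ∧ ¬ G.Adj z x := by
      intro x hx
      have := mem_nn.1 (hS hx)
      rwa [Finset.mem_filter] at this
    exact hv ⟨i, j, hij, u, hu, z, hz.1, S, fun x hx => (hS' x hx).1.1, hSc, hSs, huv, hz.2.2,
      fun x hx => (hS' x hx).1.2.2, hz.2.1, fun x hx => (hS' x hx).1.2.1, fun x hx => (hS' x hx).2⟩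
  have cover : ∀ x, (nn G x (L i)).card ≤ (nn G x X).card + (nn G x W).card + w ^ (s+3) := by
    intro x
    have h1 : nn G x (L i) ⊆ nn G x X ∪ nn G x W ∪ nn G u (L i) := by
      intro a ha
      simp only [Finset.mem_union, mem_nn, hX, hW, Finset.mem_filter] at ha ⊢
      tauto
    have h2 := (Finset.card_le_card h1).trans ((Finset.card_union_le _ _).trans
      (Nat.add_le_add_right (Finset.card_union_le _ _) _))
    have h3 := H.T.few j i hij.symm u hu
    omega
  have p0 := pw15 H.hw s
  have p1 := pw15 H.hw (s+1)
  have p2 := pw15 H.hw (s+2)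
  have p3 := pw15 H.hw (s+3)
  have p4 := pw15 H.hw (s+4)
  have pp := pwpos H.hw s
  simp only [add_assoc, Nat.reduceAdd] at p0 p1 p2 p3 p4
  have hWc : 2 * w ^ (s+5) ≤ W.card := by
    have h1 := H.T3 hy0
    have h2 := cover y0
    have h3 := few y0 (Finset.mem_filter.2 ⟨hy0, huy0, hvy0⟩)
    have h4 := Finset.card_le_card (nn_subset (G := G) (v := y0) (S := W))
    omega
  have hW' : W.card ≤ 14 * w ^ (s+6) := (Finset.card_le_card hWL).trans (H.T.hi i)
  have hsum : ∑ x ∈ X, (nn G x W).card ≤ W.card * w ^ s := by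
    rw [sum_nn, ← smul_eq_mul]
    exact Finset.sum_le_card_nsmul _ _ _ (fun z hz => (few z hz).le)
  have hex : ∃ x ∈ X, (nn G x W).card ≤ w ^ (s+5) := by
    by_contra hcon
    push Not at hcon
    have h1 : X.card * w ^ (s+5) ≤ ∑ x ∈ X, (nn G x W).card := by
      rw [← smul_eq_mul]
      exact Finset.card_nsmul_le_sum _ _ _ (fun x hx => (hcon x hx).le)
    have h2 : X.card * w ^ (s+5) ≤ (14 * w ^ (s+1)) * w ^ (s+5) := by
      calc _ ≤ W.card * w ^ s := h1.trans hsum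
        _ ≤ (14 * w ^ (s+6)) * w ^ s := Nat.mul_le_mul_right _ hW'
        _ = _ := by ring
    have h3 := Nat.le_of_mul_le_mul_right h2 (pwpos H.hw _)
    have h4 : 200 * w ^ (s+1) ≤ w ^ (s+2) := by
      calc _ ≤ w * w ^ (s+1) := Nat.mul_le_mul_right _ hw
        _ = _ := by ring
    have := pwpos H.hw (s+1)
    omega
  obtain ⟨x0, hx0, hx0W⟩ := hex
  have hXc : 2 * w ^ (s+5) ≤ X.card + w ^ (s+3) := by
    have h1 := H.T3 (hXL hx0)
    have h2 := cover x0
    have h4 := Finset.card_le_card (nn_subset (G := G) (v := x0) (S := X))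
    omega
  set X' := X.filter (fun x => ¬ w ^ (s+3) < (nn G x W).card) with hX'
  have hX'X : X' ⊆ X := Finset.filter_subset _ _
  have hbad : X.card ≤ X'.card + 14 * w ^ (s+3) := by
    have h1 := bad_count G W X 1 (w ^ s) (w ^ (s+3)) (fun z hz => by rw [one_mul]; exact (few z hz).le)
    have h2 : (X.filter (fun x => w ^ (s+3) < (nn G x W).card)).card * w ^ (s+3) ≤
        (14 * w ^ (s+3)) * w ^ (s+3) := by
      rw [one_mul] at h1
      calc _ ≤ W.card * w ^ s := h1
        _ ≤ (14 * w ^ (s+6)) * w ^ s := Nat.mul_le_mul_right _ hW'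
        _ = _ := by ring
    have h3 := Nat.le_of_mul_le_mul_right h2 (pwpos H.hw _)
    have h4 : (X.filter (fun x => w ^ (s+3) < (nn G x W).card)).card + X'.card = X.card :=
      Finset.card_filter_add_card_filter_not _
    omega
  let M : ι → Finset V := fun l => if l = i then W else L l
  have hMi : M i = W := if_pos rfl
  have hMl : ∀ l, l ≠ i → M l = L l := fun l hl => if_neg hl
  have hML : ∀ l, M l ⊆ L l := by
    intro l
    by_cases hl : l = i
    · subst hl; rw [hMi]; exact hWL
    · rw [hMl l hl]
  have hTM : Tpl G w s L0 M := by
    refine H.T.sub id Function.injective_id M hML ?_ _ H.T.cl0 ?_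
    · intro l
      by_cases hl : l = i
      · subst hl; rw [hMi]; omega
      · rw [hMl l hl]; exact H.T.lo l
    · intro a ha l b hb
      exact H.T.com a ha l b (hML l hb)
  have hTM' : Tpl G w s L0 (Sum.elim M (fun _ : Unit => X')) := by
    refine hTM.ext _ ?_ ?_ ?_ ?_ ?_ ?_ ?_ ?_
    · intro a ha _ b hb; exact H.T.com a ha i b (hXL (hX'X hb))
    · intro i j hij; exact absurd (Subsingleton.elim i j) hij
    · intro l _
      by_cases hl : l = i
      · subst hl
        rw [hMi, Finset.disjoint_left]
        intro a ha ha'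
        exact (Finset.mem_filter.1 (hX'X ha')).2.2 (Finset.mem_filter.1 ha).2.2
      · rw [hMl l hl]
        exact (H.T.dj l i hl).mono (Finset.Subset.refl _) (hX'X.trans hXL)
    · intro _; omega
    · intro _; exact (Finset.card_le_card (hX'X.trans hXL)).trans (H.T.hi i)
    · intro i j hij; exact absurd (Subsingleton.elim i j) hij
    · intro l _ a ha
      by_cases hl : l = i
      · subst hl
        rw [hMi] at ha
        have h1 := few a ha
        have h2 := Finset.card_le_card (nn_mono (G := G) (v := a) hX'X)
        omega
      · rw [hMl l hl] at ha
        exact (Finset.card_le_card (nn_mono (hX'X.trans hXL))).trans (H.T.few l i hl a ha)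
    · intro l _ a ha
      by_cases hl : l = i
      · subst hl
        rw [hMi]
        exact not_lt.1 (Finset.mem_filter.1 ha).2
      · rw [hMl l hl]
        exact H.T.few i l (Ne.symm hl) a (hXL (hX'X ha))
  have hopt := H.opt _ _ _ hTM' H.L0A (by
    rintro (l | l)
    · exact (hML l).trans (H.LA l)
    · exact (hX'X.trans hXL).trans (H.LA i))
  rw [tval_ext] at hopt
  unfold tval at hopt
  simp only [Finset.univ_unique, Finset.sum_const,
    Finset.card_singleton, one_smul, Fintype.card_unit, one_mul] at hopt
  rw [← Finset.add_sum_erase _ _ (Finset.mem_univ i),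
    ← Finset.add_sum_erase _ (fun i => (L i).card) (Finset.mem_univ i), hMi,
    Finset.sum_congr rfl (fun l hl => by rw [hMl l (Finset.mem_erase.1 hl).1])] at hopt
  have hcov : (L i).card ≤ X.card + W.card + w ^ (s+3) := by
    have h1 : L i ⊆ X ∪ W ∪ nn G u (L i) := by
      intro a ha
      simp only [Finset.mem_union, mem_nn, hX, hW, Finset.mem_filter] at ha ⊢
      tauto
    have h2 := (Finset.card_le_card h1).trans ((Finset.card_union_le _ _).trans
      (Nat.add_le_add_right (Finset.card_union_le _ _) _))
    have h3 := H.T.few j i hij.symm u hu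
    omega
  simp only [] at hopt
  omega

theorem pure (H : Ctx G w s A L0 L) (hw : 200 ≤ w) {v : V} (hv : ¬ Pend G s L v)
    (hd : ∀ j, ∀ u ∈ L j, ∃ i, i ≠ j ∧
      w ^ (s+2) ≤ 14 * ((L i).filter (fun x => G.Adj u x ∧ ¬ G.Adj v x)).card) :
    (∃ i₁ i₂, i₁ ≠ i₂ ∧ (∀ x ∈ L i₁, ¬ G.Adj v x) ∧ (∀ x ∈ L i₂, ¬ G.Adj v x)) ∧
    ∀ i, (∀ x ∈ L i, ¬ G.Adj v x) ∨ 7 * (nn G v (L i)).card ≤ w ^ (s+2) := by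
  have p0 := pw15 H.hw s
  have p1 := pw15 H.hw (s+1)
  have p2 := pw15 H.hw (s+2)
  have p3 := pw15 H.hw (s+3)
  have p4 := pw15 H.hw (s+4)
  have pp := pwpos H.hw s
  simp only [add_assoc, Nat.reduceAdd] at p0 p1 p2 p3 p4
  have A1 : ∀ j, ∀ u ∈ L j, ¬ G.Adj v u → ∃ i, i ≠ j ∧ ∀ x ∈ L i, ¬ G.Adj v x := by
    intro j u hu huv
    obtain ⟨i, hij, hi⟩ := hd j u hu
    refine ⟨i, hij, ?_⟩
    have h1 := (H.star hw hv hij hu huv).resolve_right (by omega)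
    by_contra hcon
    push Not at hcon
    obtain ⟨y, hy, hvy⟩ := hcon
    -- `v` has few neighbours in `L i`
    have h2 : ((L i).filter (fun x => G.Adj v x)).card ≤ w ^ (s+3) := by
      refine (Finset.card_le_card ?_).trans (H.T.few j i hij.symm u hu)
      intro x hx
      rw [Finset.mem_filter] at hx
      exact mem_nn.2 ⟨hx.1, fun h => h1 x hx.1 h hx.2⟩
    have h3 := nn_compl_card G v (L i)
    have h4 := H.T2 i
    -- `v` is adjacent to all neighbours of `y` in the other sets
    have h5 : ∀ l, l ≠ i → ∀ z ∈ L l, G.Adj z y → G.Adj v z := by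
      intro l hl z hz hzy
      by_contra hvz
      rcases H.star hw hv hl.symm hz hvz with h | h
      · exact h y hy hzy hvy
      · have e1 := H.T.few l i hl z hz
        have e2 : L i ⊆ (L i).filter (fun x => G.Adj z x ∧ ¬ G.Adj v x) ∪ nn G z (L i) ∪
            (L i).filter (fun x => G.Adj v x) := by
          intro a ha
          simp only [Finset.mem_union, mem_nn, Finset.mem_filter]
          tauto
        have e3 := (Finset.card_le_card e2).trans ((Finset.card_union_le _ _).trans
          (Nat.add_le_add_right (Finset.card_union_le _ _) _))
        omega
    obtain ⟨u', hu'⟩ := Finset.card_pos.1 (show 0 < (nn G v (L i)).card by omega)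
    rw [mem_nn] at hu'
    obtain ⟨l, hl, hl'⟩ := hd i u' hu'.1
    have h6 := (H.star hw hv hl hu'.1 hu'.2).resolve_right (by omega)
    have e1 := H.T.few i l hl.symm u' hu'.1
    have e2 := H.T.few i l hl.symm y hy
    have e3 : L l ⊆ nn G u' (L l) ∪ nn G y (L l) := by
      intro z hz
      by_contra hcon
      simp only [Finset.mem_union, mem_nn, hz, true_and, not_or, not_not] at hcon
      exact h6 z hz hcon.1 (h5 l hl z hz hcon.2.symm)
    have e4 := (Finset.card_le_card e3).trans (Finset.card_union_le _ _)
    have e5 := H.T2 l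
    omega
  have hne : ∀ i, (L i).Nonempty := by
    intro i
    have := H.T2 i
    exact Finset.card_pos.1 (by omega)
  have hι : Nonempty ι := Fintype.card_pos_iff.1 (by have := H.T6; omega)
  obtain ⟨j⟩ := hι
  obtain ⟨u, hu⟩ := hne j
  obtain ⟨i, hij, hi⟩ := hd j u hu
  obtain ⟨x, hx⟩ := Finset.card_pos.1 (show 0 < ((L i).filter (fun x => G.Adj u x ∧ ¬ G.Adj v x)).card
    by omega)
  rw [Finset.mem_filter] at hx
  obtain ⟨i1, -, h1⟩ := A1 i x hx.1 hx.2.2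
  obtain ⟨u1, hu1⟩ := hne i1
  obtain ⟨i2, h21, h2⟩ := A1 i1 u1 hu1 (h1 u1 hu1)
  refine ⟨⟨i1, i2, h21.symm, h1, h2⟩, ?_⟩
  intro i
  by_cases hno : ∀ x ∈ L i, ¬ G.Adj v x
  · exact Or.inl hno
  right
  push Not at hno
  obtain ⟨y, hy, hvy⟩ := hno
  have hi1 : i1 ≠ i := by rintro rfl; exact h1 y hy hvy
  set U := (L i1).filter (fun x => G.Adj y x) with hU
  set X := nn G v (L i) with hX
  have hUc : 4 * w ^ (s+5) ≤ U.card := by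
    have e1 := H.T.few i i1 hi1.symm y hy
    have e2 := nn_compl_card G y (L i1)
    rw [← hU] at e2
    have e3 := H.T2 i1
    omega
  have k1 : U.card * (14 * X.card) ≤ 14 * ∑ u ∈ U, (nn G u X).card + U.card * w ^ (s+2) := by
    rw [← smul_eq_mul, ← smul_eq_mul U.card, ← Finset.sum_const, ← Finset.sum_const, Finset.mul_sum,
      ← Finset.sum_add_distrib]
    refine Finset.sum_le_sum (fun u hu => ?_)
    rw [Finset.mem_filter] at hu
    have e1 := (H.star hw hv hi1.symm hu.1 (h1 u hu.1)).resolve_left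
      (fun h => h y hy hu.2.symm hvy)
    have e2 := nn_compl_card G u X
    have e3 : X.filter (fun x => G.Adj u x) ⊆ (L i).filter (fun x => G.Adj u x ∧ ¬ G.Adj v x) := by
      intro x hx
      rw [Finset.mem_filter, mem_nn] at hx
      exact Finset.mem_filter.2 ⟨hx.1.1, hx.2, hx.1.2⟩
    have e4 := Finset.card_le_card e3
    omega
  have k2 : ∑ u ∈ U, (nn G u X).card ≤ X.card * w ^ (s+3) := by
    rw [← sum_nn, ← smul_eq_mul]
    refine Finset.sum_le_card_nsmul _ _ _ (fun x hx => ?_)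
    rw [mem_nn] at hx
    exact (Finset.card_le_card (nn_mono (Finset.filter_subset _ _))).trans
      (H.T.few i i1 hi1.symm x hx.1)
  have k3 : 4 * (X.card * w ^ (s+3)) ≤ U.card * X.card := by
    calc _ = (4 * w ^ (s+3)) * X.card := by ring
      _ ≤ _ := Nat.mul_le_mul_right _ (by omega)
  have k4 : U.card * (7 * X.card) ≤ U.card * w ^ (s+2) := by
    have e1 : U.card * (14 * X.card) = 14 * (U.card * X.card) := by ring
    have e2 : U.card * (7 * X.card) = 7 * (U.card * X.card) := by ring
    omega
  exact Nat.le_of_mul_le_mul_left k4 (by omega)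

theorem LU_card (H : Ctx G w s A L0 L) : (Finset.univ.biUnion L).card ≤ 14 * w ^ (s+7) := by
  have h1 := Finset.card_biUnion_le_card_mul Finset.univ L _ (fun i _ => H.T.hi i)
  rw [Finset.card_univ] at h1
  have h2 := H.T1
  calc _ ≤ _ := h1
    _ ≤ w * (14 * w ^ (s+6)) := Nat.mul_le_mul_right _ (by omega)
    _ = _ := by ring

/-- the class of a pendant triple -/
theorem pend_class (H : Ctx G w s A L0 L) {u y : V} {S : Finset V} (hSc : S.card = s)
    (hSs : St G S) (huy : G.Adj u y) (huS : ∀ x ∈ S, G.Adj u x) (hyS : ∀ x ∈ S, ¬ G.Adj y x)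
    {T : Finset V} (hT1 : ∀ v ∈ T, ¬ G.Adj v u) (hT2 : ∀ v ∈ T, G.Adj v y)
    (hT3 : ∀ v ∈ T, ∀ x ∈ S, ¬ G.Adj v x) (hT4 : u ∉ T) (hTc : T.card = s) (hTs : St G T) :
    False := by
  have hs := H.hs
  obtain ⟨v, hv⟩ := Finset.card_pos.1 (show 0 < T.card by omega)
  refine H.ds y u T S huy.symm hTc hSc hTs hSs hT3 (fun x hx => (hT2 x hx).symm) huS hyS
    (fun x hx h => hT1 x hx h.symm) hT4 ?_
  intro hy
  exact hT3 v hv y hy (hT2 v hv)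

theorem pend_card (H : Ctx G w s A L0 L) (P : Finset V) (hP : ∀ v ∈ P, Pend G s L v)
    (hPL : ∀ v ∈ P, ∀ i, v ∉ L i) : P.card ≤ w ^ ((2*s+1)*(s+7) - 1) := by
  set U := Finset.univ.biUnion L with hU
  have hUm : ∀ {i x}, x ∈ L i → x ∈ U := fun {i x} h => Finset.mem_biUnion.2 ⟨i, Finset.mem_univ _, h⟩
  have hUn : ∀ {x}, x ∈ U → x ∉ P := by
    intro x hx hxP
    obtain ⟨i, -, hi⟩ := Finset.mem_biUnion.1 hx
    exact hPL x hxP i hi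
  let cls : V × V × Finset V → Finset V := fun t => P.filter (fun v =>
    ¬ G.Adj v t.1 ∧ G.Adj v t.2.1 ∧ ∀ x ∈ t.2.2, ¬ G.Adj v x)
  let I : Finset (V × V × Finset V) := (U ×ˢ (U ×ˢ U.powersetCard s)).filter (fun t =>
    St G t.2.2 ∧ G.Adj t.1 t.2.1 ∧ (∀ x ∈ t.2.2, G.Adj t.1 x) ∧ ∀ x ∈ t.2.2, ¬ G.Adj t.2.1 x)
  have hcov : P ⊆ I.biUnion cls := by
    intro v hv
    obtain ⟨i, j, hij, u, hu, y, hy, S, hS, hSc, hSs, h1, h2, h3, h4, h5, h6⟩ := hP v hv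
    refine Finset.mem_biUnion.2 ⟨(u, y, S), ?_, Finset.mem_filter.2 ⟨hv, h1, h2, h3⟩⟩
    refine Finset.mem_filter.2 ⟨?_, hSs, h4, h5, h6⟩
    simp only [Finset.mem_product, Finset.mem_powersetCard]
    exact ⟨hUm hu, hUm hy, fun x hx => hUm (hS hx), hSc⟩
  have hcls : ∀ t ∈ I, ∀ T ⊆ cls t, T.card = s → St G T → False := by
    rintro ⟨u, y, S⟩ ht T hT hTc hTs
    obtain ⟨ht1, hSs, huy, huS, hyS⟩ := Finset.mem_filter.1 ht
    simp only [Finset.mem_product, Finset.mem_powersetCard] at ht1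
    have hT' : ∀ v ∈ T, v ∈ P ∧ ¬ G.Adj v u ∧ G.Adj v y ∧ ∀ x ∈ S, ¬ G.Adj v x :=
      fun v hv => Finset.mem_filter.1 (hT hv)
    exact H.pend_class ht1.2.2.2 hSs huy huS hyS (fun v hv => (hT' v hv).2.1)
      (fun v hv => (hT' v hv).2.2.1) (fun v hv => (hT' v hv).2.2.2)
      (fun h => hUn ht1.1 (hT' u h).1) hTc hTs
  by_cases hs1 : s = 1
  · have : P = ∅ := by
      rw [Finset.eq_empty_iff_forall_notMem]
      intro v hv
      obtain ⟨t, ht, hvt⟩ := Finset.mem_biUnion.1 (hcov hv)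
      refine hcls t ht {v} (by simpa using hvt) (by simp [hs1]) ?_
      intro a ha b hb
      rw [Finset.mem_singleton] at ha hb
      rw [ha, hb]; exact G.irrefl
    simp [this]
  have hs2 : 2 ≤ s := by have := H.hs; omega
  have hw := H.hw
  have h1 : P.card ≤ I.card * w ^ s := by
    refine (Finset.card_le_card hcov).trans (Finset.card_biUnion_le_card_mul _ _ _ ?_)
    intro t ht
    by_contra hcon
    obtain ⟨T, hT, hTc, hTs⟩ := ramsey G w (by omega) H.cl s (cls t) (by omega)
    exact hcls t ht T hT hTc hTs
  have hUc : U.card ≤ w ^ (s+8) := by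
    have h0 := H.LU_card
    rw [← hU] at h0
    have := pw15 hw (s+7)
    simp only [add_assoc, Nat.reduceAdd] at this
    omega
  have h2 : I.card ≤ U.card * (U.card * U.card ^ s) := by
    refine (Finset.card_filter_le _ _).trans ?_
    rw [Finset.card_product, Finset.card_product, Finset.card_powersetCard]
    gcongr
    exact Nat.choose_le_pow _ _
  calc P.card ≤ U.card * (U.card * U.card ^ s) * w ^ s := h1.trans (Nat.mul_le_mul_right _ h2)
    _ ≤ w ^ (s+8) * (w ^ (s+8) * (w ^ (s+8)) ^ s) * w ^ s := by gcongr
    _ = w ^ ((s+8) + ((s+8) + (s+8)*s) + s) := by rw [← pow_mul]; ring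
    _ ≤ _ := by
      apply Nat.pow_le_pow_right (by omega)
      apply Nat.le_sub_of_add_le
      nlinarith

end Ctx
end Aux

section Aux
open scoped Classical
set_option linter.unusedSectionVars false

variable {V : Type*} [Fintype V]

/-- pure vertices -/
structure Pu (G : SimpleGraph V) (w s : ℕ) {ι : Type} (L : ι → Finset V) (v : V) : Prop where
  out : ∀ i, v ∉ L i
  nb : ∃ i, ∃ x ∈ L i, G.Adj v x
  non : ∃ i, ∀ x ∈ L i, ¬ G.Adj v x
  pur : ∀ i, (∀ x ∈ L i, ¬ G.Adj v x) ∨ 7 * (nn G v (L i)).card ≤ w ^ (s+2)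

/-- indices without neighbours -/
noncomputable def Cv (G : SimpleGraph V) {ι : Type} [Fintype ι] (L : ι → Finset V) (v : V) :
    Finset ι := Finset.univ.filter (fun i => ∀ x ∈ L i, ¬ G.Adj v x)

theorem mem_Cv {G : SimpleGraph V} {ι : Type} [Fintype ι] {L : ι → Finset V} {v : V} {i : ι} :
    i ∈ Cv G L v ↔ ∀ x ∈ L i, ¬ G.Adj v x := by simp [Cv]

/-- comparable or disjoint -/
def Lam {ι : Type} (X Y : Finset ι) : Prop := X ⊆ Y ∨ Y ⊆ X ∨ Disjoint X Y

namespace Ctx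
variable {G : SimpleGraph V} {w s : ℕ} {ι : Type} [Fintype ι] {A L0 : Finset V} {L : ι → Finset V}

theorem common (H : Ctx G w s A L0 L) (T : Finset V) (hT : T.card ≤ 7 * w ^ 3)
    (hP : ∀ t ∈ T, Pu G w s L t) {i : ι} (hi : ∀ t ∈ T, i ∉ Cv G L t) :
    4 * w ^ (s+5) ≤ ((L i).filter (fun y => ∀ t ∈ T, G.Adj t y)).card := by
  have h1 : L i ⊆ (L i).filter (fun y => ∀ t ∈ T, G.Adj t y) ∪ T.biUnion (fun t => nn G t (L i)) := by
    intro y hy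
    by_cases h : ∀ t ∈ T, G.Adj t y
    · exact Finset.mem_union_left _ (Finset.mem_filter.2 ⟨hy, h⟩)
    · push Not at h
      obtain ⟨t, ht, h⟩ := h
      exact Finset.mem_union_right _ (Finset.mem_biUnion.2 ⟨t, ht, mem_nn.2 ⟨hy, h⟩⟩)
  have h2 := (Finset.card_le_card h1).trans (Finset.card_union_le _ _)
  have h3 : 7 * (T.biUnion (fun t => nn G t (L i))).card ≤ 7 * w ^ (s+5) := by
    calc _ ≤ 7 * ∑ t ∈ T, (nn G t (L i)).card := Nat.mul_le_mul_left _ Finset.card_biUnion_le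
      _ = ∑ t ∈ T, 7 * (nn G t (L i)).card := Finset.mul_sum _ _ _
      _ ≤ T.card • w ^ (s+2) := Finset.sum_le_card_nsmul _ _ _ (fun t ht =>
          ((hP t ht).pur i).resolve_left (fun h => hi t ht (mem_Cv.2 h)))
      _ ≤ (7 * w ^ 3) * w ^ (s+2) := by rw [smul_eq_mul]; exact Nat.mul_le_mul_right _ hT
      _ = _ := by ring
  have h4 := H.T2 i
  omega

theorem stableIn (H : Ctx G w s A L0 L) {X : Finset V} {l : ι}
    (hX : 4 * w ^ (s+5) ≤ X.card) : ∃ S ⊆ X, S.card = s ∧ St G S := by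
  have hw := H.hw
  refine ramsey G w (by omega) H.cl s X ?_
  have : w ^ s ≤ w ^ (s+5) := Nat.pow_le_pow_right (by omega) (by omega)
  omega

theorem F1 (H : Ctx G w s A L0 L) (hsw : s ≤ 7 * w ^ 3) {i j : ι} (hij : i ≠ j)
    {T T' : Finset V} (hT : ∀ t ∈ T, Pu G w s L t ∧ i ∉ Cv G L t ∧ j ∈ Cv G L t)
    (hT' : ∀ t ∈ T', Pu G w s L t ∧ j ∉ Cv G L t ∧ i ∈ Cv G L t)
    (hTc : T.card = s) (hTc' : T'.card = s) (hTs : St G T) (hTs' : St G T')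
    (hTT : ∀ x ∈ T, ∀ y ∈ T', ¬ G.Adj x y) : False := by
  have h1 := H.common T (by omega) (fun t ht => (hT t ht).1) (i := i) (fun t ht => (hT t ht).2.1)
  have h2 := H.common T' (by omega) (fun t ht => (hT' t ht).1) (i := j) (fun t ht => (hT' t ht).2.1)
  have p3 := pw15 H.hw (s+3)
  have p4 := pw15 H.hw (s+4)
  have pp := pwpos H.hw (s+3)
  simp only [add_assoc, Nat.reduceAdd] at p3 p4
  obtain ⟨y, hy⟩ := Finset.card_pos.1 (lt_of_lt_of_le (show 0 < 4 * w ^ (s+5) by omega) h1)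
  rw [Finset.mem_filter] at hy
  have h3 := H.T.few i j hij y hy.1
  obtain ⟨b, hb, hb'⟩ := Finset.exists_mem_notMem_of_card_lt_card
    (lt_of_le_of_lt h3 (lt_of_lt_of_le (show w ^ (s+3) < 4 * w ^ (s+5) by omega) h2))
  rw [Finset.mem_filter] at hb
  have hyb : G.Adj y b := by
    by_contra h
    exact hb' (mem_nn.2 ⟨hb.1, h⟩)
  refine H.ds y b T T' hyb hTc hTc' hTs hTs' hTT (fun x hx => (hy.2 x hx).symm)
    (fun x hx => (hb.2 x hx).symm) ?_ ?_ ?_ ?_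
  · intro x hx h
    exact mem_Cv.1 (hT' x hx).2.2 y hy.1 h.symm
  · intro x hx h
    exact mem_Cv.1 (hT x hx).2.2 b hb.1 h.symm
  · intro h; exact (hT b h).1.out j hb.1
  · intro h; exact (hT' y h).1.out i hy.1

theorem F2 (H : Ctx G w s A L0 L) {i l : ι} {v : V} (hv : Pu G w s L v) (hi : i ∉ Cv G L v)
    (hl : l ∈ Cv G L v) (X : Finset V) (hX : ∀ x ∈ X, G.Adj v x ∧ Pu G w s L x ∧ i ∈ Cv G L x ∧
      l ∈ Cv G L x) : X.card < w ^ s := by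
  by_contra hcon
  push Not at hcon
  have hw := H.hw
  obtain ⟨T, hTX, hTc, hTs⟩ := ramsey G w (by omega) H.cl s X hcon
  have : ∃ y ∈ L i, G.Adj v y := by
    by_contra h
    push Not at h
    exact hi (mem_Cv.2 h)
  obtain ⟨y, hy, hvy⟩ := this
  have hil : i ≠ l := by rintro rfl; exact hi hl
  have h1 := nn_compl_card G y (L l)
  have h2 := H.T.few i l hil y hy
  have h3 := H.T2 l
  have p3 := pw15 H.hw (s+3)
  have p4 := pw15 H.hw (s+4)
  simp only [add_assoc, Nat.reduceAdd] at p3 p4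
  obtain ⟨S, hS, hSc, hSs⟩ := H.stableIn (l := l) (X := (L l).filter (fun u => G.Adj y u)) (by omega)
  have hS' : ∀ x ∈ S, x ∈ L l ∧ G.Adj y x := fun x hx => Finset.mem_filter.1 (hS hx)
  refine H.ds v y T S hvy hTc hSc hTs hSs ?_ ?_ ?_ ?_ ?_ ?_ ?_
  · intro x hx z hz; exact mem_Cv.1 (hX x (hTX hx)).2.2.2 z (hS' z hz).1
  · intro x hx; exact (hX x (hTX hx)).1
  · intro x hx; exact (hS' x hx).2
  · intro x hx; exact mem_Cv.1 hl x (hS' x hx).1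
  · intro x hx h; exact mem_Cv.1 (hX x (hTX hx)).2.2.1 y hy h.symm
  · intro h; exact (hX y (hTX h)).2.1.out i hy
  · intro h; exact hv.out l (hS' v h).1

theorem F3 (H : Ctx G w s A L0 L) {v u : V} (hv : Pu G w s L v) (hu : Pu G w s L u)
    (hC : Cv G L u ⊂ Cv G L v) (X : Finset V)
    (hX : ∀ x ∈ X, G.Adj v x ∧ Pu G w s L x ∧ Cv G L x = Cv G L v) (hXc : 2 * w ^ s ≤ X.card) :
    ¬ G.Adj v u := by
  intro hvu
  obtain ⟨i, hi, hi'⟩ := Finset.exists_of_ssubset hC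
  obtain ⟨l, hl⟩ := hu.non
  have hl : l ∈ Cv G L u := mem_Cv.2 hl
  have h1 := H.F2 hu hi' hl (X.filter (fun x => G.Adj u x)) (by
    intro x hx
    rw [Finset.mem_filter] at hx
    obtain ⟨hx, hux⟩ := hx
    have := hX x hx
    rw [this.2.2]
    exact ⟨hux, this.2.1, hi, hC.1 hl⟩)
  have h2 := nn_compl_card G u X
  have hw := H.hw
  obtain ⟨T, hTX, hTc, hTs⟩ := ramsey G w (by omega) H.cl s (nn G u X) (by omega)
  have hT : ∀ x ∈ T, (G.Adj v x ∧ Pu G w s L x ∧ Cv G L x = Cv G L v) ∧ ¬ G.Adj u x := by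
    intro x hx
    have := mem_nn.1 (hTX hx)
    exact ⟨hX x this.1, this.2⟩
  have h3 := H.common {u} (by simp; have := pwpos H.hw 3; omega) (by simpa using hu) (i := i)
    (by simpa using hi')
  obtain ⟨S, hS, hSc, hSs⟩ := H.stableIn (l := i) h3
  have hS' : ∀ x ∈ S, x ∈ L i ∧ G.Adj u x := by
    intro x hx
    have := Finset.mem_filter.1 (hS hx)
    exact ⟨this.1, this.2 u (by simp)⟩
  refine H.ds v u T S hvu hTc hSc hTs hSs ?_ ?_ ?_ ?_ ?_ ?_ ?_
  · intro x hx z hz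
    have h4 := (hT x hx).1.2.2
    exact mem_Cv.1 (h4 ▸ hi) z (hS' z hz).1
  · intro x hx; exact (hT x hx).1.1
  · intro x hx; exact (hS' x hx).2
  · intro x hx; exact mem_Cv.1 hi x (hS' x hx).1
  · intro x hx; exact (hT x hx).2
  · intro h
    have := (hT u h).1.2.2
    exact hC.ne this
  · intro h; exact hv.out i (hS' v h).1

/-- the triple sets -/
noncomputable def Qt (G : SimpleGraph V) (L : ι → Finset V) (R : Finset V) (t : ι × ι × ι) :
    Finset V :=
  R.filter (fun v => t.1 ∉ Cv G L v ∧ t.2.1 ∈ Cv G L v ∧ t.2.2 ∈ Cv G L v)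

theorem triple (H : Ctx G w s A L0 L) (hsw : s ≤ 7 * w ^ 3) (R : Finset V)
    (hR : ∀ v ∈ R, Pu G w s L v) (i j l : ι) (h : i ≠ j) :
    (Qt G L R (i, j, l)).card ≤ (s+1) * w ^ s ∨ (Qt G L R (j, i, l)).card ≤ (s+1) * w ^ s := by
  by_contra hcon
  push Not at hcon
  obtain ⟨h1, h2⟩ := hcon
  have hw := H.hw
  obtain ⟨T, hT, hTc, hTs⟩ := ramsey G w (by omega) H.cl s (Qt G L R (i, j, l)) (by
    have : (s+1) * w ^ s = s * w ^ s + w ^ s := by ring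
    omega)
  have hT' : ∀ x ∈ T, x ∈ R ∧ i ∉ Cv G L x ∧ j ∈ Cv G L x ∧ l ∈ Cv G L x :=
    fun x hx => Finset.mem_filter.1 (hT hx)
  set Q := Qt G L R (j, i, l) with hQ
  have hQ' : ∀ x ∈ Q, x ∈ R ∧ j ∉ Cv G L x ∧ i ∈ Cv G L x ∧ l ∈ Cv G L x :=
    fun x hx => Finset.mem_filter.1 hx
  set N := T.biUnion (fun t => Q.filter (fun x => G.Adj t x)) with hN
  have hNc : N.card ≤ s * w ^ s := by
    rw [← hTc]
    refine Finset.card_biUnion_le_card_mul _ _ _ (fun t ht => (H.F2 (i := i) (l := l)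
      (hR t (hT' t ht).1) (hT' t ht).2.1 (hT' t ht).2.2.2 _ ?_).le) |>.trans (by rw [hTc])
    intro x hx
    rw [Finset.mem_filter] at hx
    have := hQ' x hx.1
    exact ⟨hx.2, hR x this.1, this.2.2⟩
  have h3 : w ^ s ≤ (Q \ N).card := by
    have e1 := Finset.card_le_card_sdiff_add_card (s := Q) (t := N)
    have : (s+1) * w ^ s = s * w ^ s + w ^ s := by ring
    omega
  obtain ⟨T', hT'Q, hTc', hTs'⟩ := ramsey G w (by omega) H.cl s _ h3
  refine H.F1 hsw h (T := T) (T' := T') ?_ ?_ hTc hTc' hTs hTs' ?_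
  · intro t ht
    have := hT' t ht
    exact ⟨hR t this.1, this.2.1, this.2.2.1⟩
  · intro t ht
    have := hQ' t (Finset.mem_sdiff.1 (hT'Q ht)).1
    exact ⟨hR t this.1, this.2.1, this.2.2.1⟩
  · intro x hx y hy hxy
    have := Finset.mem_sdiff.1 (hT'Q hy)
    exact this.2 (Finset.mem_biUnion.2 ⟨x, hx, Finset.mem_filter.2 ⟨this.1, hxy⟩⟩)

theorem triples (H : Ctx G w s A L0 L) (hsw : s ≤ 7 * w ^ 3) (R : Finset V)
    (hR : ∀ v ∈ R, Pu G w s L v) : ∃ B : Finset V, B.card ≤ w ^ (s+7) ∧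
      ∀ v ∈ R \ B, ∀ v' ∈ R \ B, Lam (Cv G L v) (Cv G L v') := by
  set J : Finset (ι × ι × ι) := Finset.univ.filter (fun t => (Qt G L R t).card ≤ (s+1) * w ^ s)
  refine ⟨J.biUnion (Qt G L R), ?_, ?_⟩
  · have h1 := Finset.card_biUnion_le_card_mul J (Qt G L R) _
      (fun t ht => (Finset.mem_filter.1 ht).2)
    have h2 : J.card ≤ w * (w * w) := by
      refine (Finset.card_le_univ _).trans ?_
      rw [Fintype.card_prod, Fintype.card_prod]
      have : Fintype.card ι ≤ w := by have := H.T1; omega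
      gcongr
    have h3 : s + 1 ≤ w ^ 4 := by
      have := pw15 H.hw 3
      have := pwpos H.hw 3
      simp only [Nat.reduceAdd] at *
      omega
    calc _ ≤ _ := h1
      _ ≤ (w * (w * w)) * (w ^ 4 * w ^ s) := by gcongr
      _ = _ := by ring
  · intro v hv v' hv'
    by_contra hcon
    unfold Lam at hcon
    push Not at hcon
    obtain ⟨h1, h2, h3⟩ := hcon
    rw [Finset.not_subset] at h1 h2
    rw [Finset.not_disjoint_iff] at h3
    obtain ⟨j, hj, hj'⟩ := h1
    obtain ⟨i, hi, hi'⟩ := h2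
    obtain ⟨l, hl, hl'⟩ := h3
    rw [Finset.mem_sdiff] at hv hv'
    have hij : i ≠ j := by rintro rfl; exact hi' hj
    rcases H.triple hsw R hR i j l hij with h | h
    · apply hv.2
      refine Finset.mem_biUnion.2 ⟨(i, j, l), Finset.mem_filter.2 ⟨Finset.mem_univ _, h⟩, ?_⟩
      exact Finset.mem_filter.2 ⟨hv.1, hi', hj, hl⟩
    · apply hv'.2
      refine Finset.mem_biUnion.2 ⟨(j, i, l), Finset.mem_filter.2 ⟨Finset.mem_univ _, h⟩, ?_⟩
      exact Finset.mem_filter.2 ⟨hv'.1, hj', hi, hl'⟩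

theorem lam_card (F : Finset (Finset ι)) (hne : ∀ C ∈ F, C.Nonempty)
    (hlam : ∀ C ∈ F, ∀ C' ∈ F, Lam C C') (hlt : ∀ C ∈ F, C.card < Fintype.card ι) :
    F.card ≤ Fintype.card ι * Fintype.card ι := by
  let f : Finset ι → Option ι × ℕ := fun C => (if h : C.Nonempty then some h.choose else none, C.card)
  have h1 : F.card ≤ ((Finset.univ.image (some : ι → Option ι)) ×ˢ
      Finset.range (Fintype.card ι)).card := by
    refine Finset.card_le_card_of_injOn f ?_ ?_
    · intro C hC
      have hC : C ∈ F := hC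
      simp only [Finset.coe_product, Set.mem_prod, Finset.mem_coe, Finset.mem_image, Finset.mem_univ,
        true_and, Finset.mem_range, f, hne C hC, dite_true]
      exact ⟨⟨_, rfl⟩, hlt C hC⟩
    · intro C hC C' hC' hCC
      have hC : C ∈ F := hC
      have hC' : C' ∈ F := hC'
      simp only [f, hne C hC, hne C' hC', dite_true, Prod.mk.injEq, Option.some.injEq] at hCC
      have m1 := (hne C hC).choose_spec
      have m2 := (hne C' hC').choose_spec
      rw [← hCC.1] at m2
      rcases hlam C hC C' hC' with h | h | h
      · exact Finset.eq_of_subset_of_card_le h hCC.2.ge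
      · exact (Finset.eq_of_subset_of_card_le h hCC.2.le).symm
      · exact absurd m2 (Finset.disjoint_left.1 h m1)
  rw [Finset.card_product, Finset.card_range,
    Finset.card_image_of_injective _ (Option.some_injective _), Finset.card_univ] at h1
  exact h1

end Ctx
end Aux

section Aux
open scoped Classical
set_option linter.unusedSectionVars false

variable {V : Type*} [Fintype V]

/-- robust cliques -/
def Rob (G : SimpleGraph V) (X : Finset V) (a q : ℕ) : Prop :=
  ∀ E : Finset V, E.card ≤ q → ∃ K ⊆ X, Cl G K ∧ Disjoint K E ∧ K.card = a

theorem Rob.mono {G : SimpleGraph V} {X : Finset V} {a q q' : ℕ} (h : Rob G X a q) (hq : q' ≤ q) :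
    Rob G X a q' := fun E hE => h E (hE.trans hq)

theorem Rob.pack {G : SimpleGraph V} {X : Finset V} {a q q' w : ℕ} (h : Rob G X a q) (ha : a ≤ w)
    (E : Finset V) (hE : E.card ≤ q') (M : ℕ) : q' + M * w ≤ q →
    ∃ K : ℕ → Finset V, (∀ m < M, K m ⊆ X ∧ Cl G (K m) ∧ Disjoint (K m) E ∧ (K m).card = a) ∧
      ∀ m < M, ∀ m' < M, m ≠ m' → Disjoint (K m) (K m') := by
  induction M with
  | zero => intro _; exact ⟨fun _ => ∅, by simp, by simp⟩
  | succ M ih =>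
    intro hq
    have e : (M+1) * w = M * w + w := by ring
    obtain ⟨K, h1, h2⟩ := ih (by omega)
    set U := (Finset.range M).biUnion K with hU
    have hUc : U.card ≤ M * w := by
      have := Finset.card_biUnion_le_card_mul (Finset.range M) K w (fun m hm => by
        rw [(h1 m (Finset.mem_range.1 hm)).2.2.2]; exact ha)
      rwa [Finset.card_range] at this
    obtain ⟨K', k1, k2, k3, k4⟩ := h (E ∪ U) (by
      have := Finset.card_union_le E U
      omega)
    rw [Finset.disjoint_union_right] at k3
    have hd : ∀ m < M, Disjoint (K m) K' := by
      intro m hm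
      exact (k3.2.mono_right (Finset.subset_biUnion_of_mem K (Finset.mem_range.2 hm))).symm
    refine ⟨fun m => if m < M then K m else K', ?_, ?_⟩
    · intro m hm
      by_cases hmM : m < M
      · simp only [hmM, if_true]; exact h1 m hmM
      · simp only [hmM, if_false]; exact ⟨k1, k2, k3.1, k4⟩
    · intro m hm m' hm' hne
      by_cases hmM : m < M <;> by_cases hmM' : m' < M
      · simp only [hmM, hmM', if_true]; exact h2 m hmM m' hmM' hne
      · simp only [hmM, hmM', if_true, if_false]; exact hd m hmM
      · simp only [hmM, hmM', if_true, if_false]; exact (hd m' hmM').symm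
      · omega

/-- semi-crowded pairs -/
def Semi (G : SimpleGraph V) (p s : ℕ) (X Y : Finset V) : Prop :=
  ∀ X' ⊆ X, p ≤ X'.card → ∃ T ⊆ X', T.card = s ∧
    (Y.filter (fun y => ∀ t ∈ T, ¬ G.Adj t y)).card < p

theorem Rob.merge {G : SimpleGraph V} {p s w a b q q' : ℕ} {X Y : Finset V}
    (hXY : Disjoint X Y) (hS : Semi G p s X Y) (hX : Rob G X a q) (hY : Rob G Y b q)
    (ha : a ≤ w) (hb : b ≤ w) (hp : 0 < p) (hw : 0 < w)
    (hq1 : q' + (p * w) * w ≤ q) (hq2 : q' + (p * ((p * w) * w) ^ s) * w ≤ q) :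
    Rob G (X ∪ Y) (a + b) q' := by
  intro E hE
  by_cases ha0 : a = 0
  · obtain ⟨K, h1, h2⟩ := hY E (by omega)
    exact ⟨K, h1.trans Finset.subset_union_right, h2.1, h2.2.1, by rw [h2.2.2]; omega⟩
  by_cases hb0 : b = 0
  · obtain ⟨K, h1, h2⟩ := hX E (by omega)
    exact ⟨K, h1.trans Finset.subset_union_left, h2.1, h2.2.1, by rw [h2.2.2]; omega⟩
  set M := p * w with hM
  set N := p * (M * w) ^ s with hN
  obtain ⟨K, hK1, hK2⟩ := hX.pack ha E hE M hq1
  obtain ⟨J, hJ1, hJ2⟩ := hY.pack hb E hE N hq2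
  by_contra hcon
  have hpair : ∀ m < M, ∀ n < N, ∃ x ∈ K m, ∃ y ∈ J n, ¬ G.Adj x y := by
    intro m hm n hn
    by_contra hno
    push Not at hno
    obtain ⟨k1, k2, k3, k4⟩ := hK1 m hm
    obtain ⟨j1, j2, j3, j4⟩ := hJ1 n hn
    refine hcon ⟨K m ∪ J n, Finset.union_subset_union k1 j1, ?_, ?_, ?_⟩
    · intro x hx y hy hxy
      rcases Finset.mem_union.1 hx with hx | hx <;> rcases Finset.mem_union.1 hy with hy | hy
      · exact k2 x hx y hy hxy
      · exact hno x hx y hy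
      · exact (hno y hy x hx).symm
      · exact j2 x hx y hy hxy
    · rw [Finset.disjoint_union_left]; exact ⟨k3, j3⟩
    · rw [Finset.card_union_of_disjoint (hXY.mono k1 j1), k4, j4]
  set U := (Finset.range M).biUnion K with hU
  have hUX : U ⊆ X := by
    intro x hx
    obtain ⟨m, hm, hx⟩ := Finset.mem_biUnion.1 hx
    exact (hK1 m (Finset.mem_range.1 hm)).1 hx
  have hUc : U.card ≤ M * w := by
    have := Finset.card_biUnion_le_card_mul (Finset.range M) K w (fun m hm => by
      rw [(hK1 m (Finset.mem_range.1 hm)).2.2.2]; exact ha)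
    rwa [Finset.card_range] at this
  have step1 : ∀ n < N, ∃ y ∈ J n, ∃ T ∈ U.powersetCard s,
      (Y.filter (fun y => ∀ t ∈ T, ¬ G.Adj t y)).card < p ∧ ∀ t ∈ T, ¬ G.Adj t y := by
    intro n hn
    have : ∀ m, ∃ xy : V × V, m < M → xy.1 ∈ K m ∧ xy.2 ∈ J n ∧ ¬ G.Adj xy.1 xy.2 := by
      intro m
      by_cases hm : m < M
      · obtain ⟨x, hx, y, hy, h⟩ := hpair m hm n hn
        exact ⟨(x, y), fun _ => ⟨hx, hy, h⟩⟩
      · have : Nonempty V := by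
          obtain ⟨x, -⟩ := Finset.card_pos.1 (show 0 < (J n).card by rw [(hJ1 n hn).2.2.2]; omega)
          exact ⟨x⟩
        obtain ⟨x⟩ := this
        exact ⟨(x, x), fun h => absurd h hm⟩
    choose f hf using this
    obtain ⟨y, hy, hyc⟩ := Finset.exists_le_card_fiber_of_mul_le_card_of_maps_to
      (s := Finset.range M) (t := J n) (f := fun m => (f m).2) (n := p)
      (fun m hm => (hf m (Finset.mem_range.1 hm)).2.1)
      (Finset.card_pos.1 (by rw [(hJ1 n hn).2.2.2]; omega))
      (by
        rw [Finset.card_range, (hJ1 n hn).2.2.2, hM, mul_comm]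
        exact Nat.mul_le_mul_left _ hb)
    set I := (Finset.range M).filter (fun m => (f m).2 = y) with hI
    have hIm : ∀ m ∈ I, m < M ∧ (f m).2 = y := fun m hm => by
      rw [hI, Finset.mem_filter, Finset.mem_range] at hm; exact hm
    have hinj : Set.InjOn (fun m => (f m).1) (I : Set ℕ) := by
      intro m hm m' hm' hmm
      by_contra hne
      have e1 := hf m (hIm m hm).1
      have e2 := hf m' (hIm m' hm').1
      simp only at hmm
      rw [← hmm] at e2
      exact Finset.disjoint_left.1 (hK2 m (hIm m hm).1 m' (hIm m' hm').1 hne) e1.1 e2.1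
    obtain ⟨T, hT, hTc, hTY⟩ := hS (I.image (fun m => (f m).1)) (by
      intro x hx
      obtain ⟨m, hm, rfl⟩ := Finset.mem_image.1 hx
      exact (hK1 m (hIm m hm).1).1 (hf m (hIm m hm).1).1) (by
      rw [Finset.card_image_of_injOn hinj]; exact hyc)
    refine ⟨y, hy, T, ?_, hTY, ?_⟩
    · rw [Finset.mem_powersetCard]
      refine ⟨?_, hTc⟩
      intro t ht
      obtain ⟨m, hm, rfl⟩ := Finset.mem_image.1 (hT ht)
      exact Finset.mem_biUnion.2 ⟨m, Finset.mem_range.2 (hIm m hm).1, (hf m (hIm m hm).1).1⟩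
    · intro t ht
      obtain ⟨m, hm, rfl⟩ := Finset.mem_image.1 (hT ht)
      have := hf m (hIm m hm).1
      rw [(hIm m hm).2] at this
      exact this.2.2
  have hMw : 0 < M * w := by positivity
  have hNpos : 0 < N := by positivity
  obtain ⟨y0, hy0, -⟩ := step1 0 hNpos
  have : ∀ n, ∃ yT : V × Finset V, n < N → yT.1 ∈ J n ∧ yT.2 ∈ U.powersetCard s ∧
      (Y.filter (fun y => ∀ t ∈ yT.2, ¬ G.Adj t y)).card < p ∧ ∀ t ∈ yT.2, ¬ G.Adj t yT.1 := by
    intro n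
    by_cases hn : n < N
    · obtain ⟨y, hy, T, hT, h⟩ := step1 n hn
      exact ⟨(y, T), fun _ => ⟨hy, hT, h⟩⟩
    · exact ⟨(y0, ∅), fun h => absurd h hn⟩
  choose f hf using this
  obtain ⟨T, hT, hTc⟩ := Finset.exists_le_card_fiber_of_mul_le_card_of_maps_to
    (s := Finset.range N) (t := U.powersetCard s) (f := fun n => (f n).2) (n := p)
    (fun n hn => (hf n (Finset.mem_range.1 hn)).2.1) ⟨_, (hf 0 hNpos).2.1⟩ (by
      rw [Finset.card_range, Finset.card_powersetCard, hN, mul_comm]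
      exact Nat.mul_le_mul_left _ ((Nat.choose_le_pow _ _).trans (Nat.pow_le_pow_left hUc _)))
  set I := (Finset.range N).filter (fun n => (f n).2 = T) with hI
  have hIm : ∀ n ∈ I, n < N ∧ (f n).2 = T := fun n hn => by
    rw [hI, Finset.mem_filter, Finset.mem_range] at hn; exact hn
  have hinj : Set.InjOn (fun n => (f n).1) (I : Set ℕ) := by
    intro m hm m' hm' hmm
    by_contra hne
    have e1 := hf m (hIm m hm).1
    have e2 := hf m' (hIm m' hm').1
    simp only at hmm
    rw [← hmm] at e2
    exact Finset.disjoint_left.1 (hJ2 m (hIm m hm).1 m' (hIm m' hm').1 hne) e1.1 e2.1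
  have h1 : I.image (fun n => (f n).1) ⊆ Y.filter (fun y => ∀ t ∈ T, ¬ G.Adj t y) := by
    intro y hy
    obtain ⟨n, hn, rfl⟩ := Finset.mem_image.1 hy
    have e := hf n (hIm n hn).1
    rw [(hIm n hn).2] at e
    exact Finset.mem_filter.2 ⟨(hJ1 n (hIm n hn).1).1 e.1, e.2.2.2⟩
  have h2 := Finset.card_le_card h1
  rw [Finset.card_image_of_injOn hinj] at h2
  obtain ⟨n, hn⟩ := Finset.card_pos.1 (show 0 < I.card by omega)
  have e := hf n (hIm n hn).1
  rw [(hIm n hn).2] at e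
  omega

theorem Rob.exists_max {G : SimpleGraph V} {w : ℕ} (X : Finset V) (q : ℕ)
    (cl : ∀ C ⊆ X, Cl G C → C.card ≤ w) :
    ∃ a, a ≤ w ∧ Rob G X a q ∧ ∃ E : Finset V, E.card ≤ q ∧ ∀ C ⊆ X \ E, Cl G C → C.card ≤ a := by
  have h0 : Rob G X 0 q := fun E _ => ⟨∅, by simp, by simp [Cl], by simp, by simp⟩
  have hle : ∀ a, Rob G X a q → a ≤ w := by
    intro a ha
    obtain ⟨K, h1, h2, h3, h4⟩ := ha ∅ (by simp)
    rw [← h4]; exact cl K h1 h2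
  have : ∃ a, Rob G X a q ∧ ¬ Rob G X (a+1) q := by
    by_contra hcon
    push Not at hcon
    have : ∀ a, Rob G X a q := by
      intro a
      induction a with
      | zero => exact h0
      | succ a ih => exact hcon a ih
    have := hle (w+1) (this _)
    omega
  obtain ⟨a, ha, hna⟩ := this
  refine ⟨a, hle a ha, ha, ?_⟩
  unfold Rob at hna
  push Not at hna
  obtain ⟨E, hE, hE'⟩ := hna
  refine ⟨E, hE, ?_⟩
  intro C hC hCl
  by_contra hcon
  obtain ⟨K, hK, hKc⟩ := Finset.exists_subset_card_eq (show a+1 ≤ C.card by omega)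
  refine hE' K (fun x hx => (Finset.mem_sdiff.1 (hC (hK hx))).1)
    (fun x hx y hy => hCl x (hK hx) y (hK hy)) ?_ hKc
  rw [Finset.disjoint_left]
  intro x hx
  exact (Finset.mem_sdiff.1 (hC (hK hx))).2

/-! ### arithmetic -/

theorem pow_two_sum (d x y : ℕ) : (x+1)^d + (y+1)^d ≤ (x+y+1)^d + 1 := by
  induction d with
  | zero => simp
  | succ d ih =>
    have h1 : 1 ≤ (x+1)^d := Nat.one_le_pow _ _ (by omega)
    have h2 : 1 ≤ (y+1)^d := Nat.one_le_pow _ _ (by omega)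
    rw [pow_succ, pow_succ, pow_succ]
    have h3 := Nat.mul_le_mul_left (x+y+1) ih
    nlinarith [Nat.mul_le_mul_left y h1, Nat.mul_le_mul_left x h2]

theorem sum_pow_le {β : Type*} (J : Finset β) (a : β → ℕ) (d : ℕ) (hd : 1 ≤ d) :
    ∑ j ∈ J, a j ^ d ≤ (∑ j ∈ J, a j) ^ d := by
  induction J using Finset.induction_on with
  | empty => simp
  | insert j J hj ih =>
    rw [Finset.sum_insert hj, Finset.sum_insert hj]
    calc _ ≤ a j ^ d + (∑ j ∈ J, a j) ^ d := by gcongr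
      _ ≤ _ := pow_add_pow_le (Nat.zero_le _) (Nat.zero_le _) (by omega)

theorem sum_pow_le' {β : Type*} (J : Finset β) (a : β → ℕ) (d w : ℕ) (hd : 1 ≤ d)
    (h1 : ∀ j ∈ J, a j ≤ w - 1) (h2 : ∑ j ∈ J, a j ≤ w) :
    ∑ j ∈ J, a j ^ d ≤ (w-1) ^ d + 1 := by
  by_cases h0 : ∀ j ∈ J, a j = 0
  · rw [Finset.sum_eq_zero]
    · omega
    · intro j hj; rw [h0 j hj]; exact zero_pow (by omega)
  push Not at h0
  obtain ⟨j, hj, hj0⟩ := h0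
  have hrest := sum_pow_le (J.erase j) a d hd
  rw [← Finset.add_sum_erase _ _ hj] at h2 ⊢
  set r := ∑ j ∈ J.erase j, a j
  have hjw := h1 j hj
  by_cases hr : r = 0
  · rw [hr, zero_pow (by omega)] at hrest
    have := Nat.pow_le_pow_left hjw d
    omega
  · have e := pow_two_sum d (a j - 1) (r - 1)
    rw [show a j - 1 + 1 = a j by omega, show r - 1 + 1 = r by omega] at e
    have := Nat.pow_le_pow_left (show a j - 1 + (r-1) + 1 ≤ w - 1 by omega) d
    omega

/-! ### laminar colouring -/

theorem lam_offset {ι : Type} (g : Finset ι → ℕ) (N : ℕ) : ∀ (F : Finset (Finset ι)), F.card ≤ N →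
    (∀ C ∈ F, C.Nonempty) → (∀ C ∈ F, ∀ C' ∈ F, Lam C C') → ∀ n : ℕ,
    (∀ J ⊆ F, (∀ C ∈ J, ∀ C' ∈ J, C ≠ C' → Disjoint C C') → ∑ C ∈ J, g C ≤ n) →
    ∃ o : Finset ι → ℕ, (∀ C ∈ F, o C + g C ≤ n) ∧
      ∀ C ∈ F, ∀ C' ∈ F, Disjoint C C' → o C + g C ≤ o C' ∨ o C' + g C' ≤ o C := by
  induction N with
  | zero =>
    intro F hF _ _ n _
    rw [Nat.le_zero, Finset.card_eq_zero] at hF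
    subst hF
    exact ⟨fun _ => 0, by simp, by simp⟩
  | succ N ih =>
    intro F hFN hne hlam n hn
    by_cases hF0 : F = ∅
    · subst hF0; exact ⟨fun _ => 0, by simp, by simp⟩
    obtain ⟨C, hC, hmax⟩ := Finset.exists_max_image F Finset.card
      (Finset.nonempty_iff_ne_empty.2 hF0)
    set F1 := F.filter (fun D => D ⊆ C) with hF1
    set F2 := F.filter (fun D => ¬ D ⊆ C) with hF2
    have m1 : ∀ {D}, D ∈ F1 ↔ D ∈ F ∧ D ⊆ C := by intro D; simp [hF1]
    have m2 : ∀ {D}, D ∈ F2 ↔ D ∈ F ∧ ¬ D ⊆ C := by intro D; simp [hF2]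
    have hCF1 : C ∈ F1 := m1.2 ⟨hC, Finset.Subset.refl _⟩
    have hdis2 : ∀ D ∈ F2, Disjoint D C := by
      intro D hD
      rw [m2] at hD
      rcases hlam D hD.1 C hC with h | h | h
      · exact absurd h hD.2
      · have := Finset.eq_of_subset_of_card_le h (hmax D hD.1)
        exact absurd (this ▸ Finset.Subset.refl _) hD.2
      · exact h
    have hcard : F1.card + F2.card = F.card := Finset.card_filter_add_card_filter_not _
    by_cases hF2e : F2 = ∅
    · -- everything inside `C`
      have hall : ∀ D ∈ F, D ⊆ C := by
        intro D hD
        by_contra h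
        have : D ∈ F2 := m2.2 ⟨hD, h⟩
        rw [hF2e] at this
        simp at this
      obtain ⟨o, ho1, ho2⟩ := ih (F.erase C) (by rw [Finset.card_erase_of_mem hC]; omega)
        (fun D hD => hne D (Finset.mem_erase.1 hD).2)
        (fun D hD D' hD' => hlam D (Finset.mem_erase.1 hD).2 D' (Finset.mem_erase.1 hD').2) n
        (fun J hJ => hn J (hJ.trans (Finset.erase_subset _ _)))
      have hnd : ∀ D ∈ F, ¬ Disjoint D C := by
        intro D hD h
        obtain ⟨x, hx⟩ := hne D hD
        exact Finset.disjoint_left.1 h hx (hall D hD hx)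
      refine ⟨fun D => if D = C then 0 else o D, ?_, ?_⟩
      · intro D hD
        by_cases hDC : D = C
        · subst hDC
          have := hn {D} (by simpa using hD) (by
            intro a ha b hb hab
            rw [Finset.mem_singleton] at ha hb
            exact absurd (ha.trans hb.symm) hab)
          simpa using this
        · simp only [hDC, if_false]
          exact ho1 D (Finset.mem_erase.2 ⟨hDC, hD⟩)
      · intro D hD D' hD' hdis
        by_cases hDC : D = C
        · subst hDC; exact absurd hdis.symm (hnd D' hD')
        by_cases hDC' : D' = C
        · subst hDC'; exact absurd hdis (hnd D hD)
        simp only [hDC, hDC', if_false]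
        exact ho2 D (Finset.mem_erase.2 ⟨hDC, hD⟩) D' (Finset.mem_erase.2 ⟨hDC', hD'⟩) hdis
    · have hF2p : 0 < F2.card := Finset.card_pos.2 (Finset.nonempty_iff_ne_empty.2 hF2e)
      have hF1p : 0 < F1.card := Finset.card_pos.2 ⟨C, hCF1⟩
      let P : Finset (Finset ι) → Prop := fun J => ∀ C ∈ J, ∀ C' ∈ J, C ≠ C' → Disjoint C C'
      have hP0 : P ∅ := by simp [P]
      obtain ⟨J1, hJ1, hJ1m⟩ := Finset.exists_max_image (F1.powerset.filter P)
        (fun J => ∑ C ∈ J, g C) ⟨∅, Finset.mem_filter.2 ⟨by simp, hP0⟩⟩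
      obtain ⟨J2, hJ2, hJ2m⟩ := Finset.exists_max_image (F2.powerset.filter P)
        (fun J => ∑ C ∈ J, g C) ⟨∅, Finset.mem_filter.2 ⟨by simp, hP0⟩⟩
      simp only [Finset.mem_filter, Finset.mem_powerset] at hJ1 hJ2 hJ1m hJ2m
      set n1 := ∑ C ∈ J1, g C with hn1
      set n2 := ∑ C ∈ J2, g C with hn2
      have hcross : ∀ D ∈ F1, ∀ D' ∈ F2, Disjoint D D' := by
        intro D hD D' hD'
        exact ((hdis2 D' hD').mono_right (m1.1 hD).2).symm
      have hJd : Disjoint J1 J2 := by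
        rw [Finset.disjoint_left]
        intro D h1 h2
        exact (m2.1 (hJ2.1 h2)).2 (m1.1 (hJ1.1 h1)).2
      have hsum : n1 + n2 ≤ n := by
        rw [hn1, hn2, ← Finset.sum_union hJd]
        apply hn
        · intro D hD
          rcases Finset.mem_union.1 hD with h | h
          · exact (m1.1 (hJ1.1 h)).1
          · exact (m2.1 (hJ2.1 h)).1
        · intro D hD D' hD' hne'
          rcases Finset.mem_union.1 hD with h | h <;> rcases Finset.mem_union.1 hD' with h' | h'
          · exact hJ1.2 D h D' h' hne'
          · exact hcross D (hJ1.1 h) D' (hJ2.1 h')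
          · exact (hcross D' (hJ1.1 h') D (hJ2.1 h)).symm
          · exact hJ2.2 D h D' h' hne'
      obtain ⟨o1, ho1, ho1'⟩ := ih F1 (by omega) (fun D hD => hne D (m1.1 hD).1)
        (fun D hD D' hD' => hlam D (m1.1 hD).1 D' (m1.1 hD').1) n1
        (fun J hJ hJP => hJ1m J ⟨hJ, hJP⟩)
      obtain ⟨o2, ho2, ho2'⟩ := ih F2 (by omega) (fun D hD => hne D (m2.1 hD).1)
        (fun D hD D' hD' => hlam D (m2.1 hD).1 D' (m2.1 hD').1) n2
        (fun J hJ hJP => hJ2m J ⟨hJ, hJP⟩)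
      refine ⟨fun D => if D ⊆ C then o1 D else n1 + o2 D, ?_, ?_⟩
      · intro D hD
        by_cases h : D ⊆ C
        · simp only [h, if_true]; have := ho1 D (m1.2 ⟨hD, h⟩); omega
        · simp only [h, if_false]; have := ho2 D (m2.2 ⟨hD, h⟩); omega
      · intro D hD D' hD' hdis
        by_cases h : D ⊆ C <;> by_cases h' : D' ⊆ C <;> simp only [h, h', if_true, if_false]
        · exact ho1' D (m1.2 ⟨hD, h⟩) D' (m1.2 ⟨hD', h'⟩) hdis
        · left; have := ho1 D (m1.2 ⟨hD, h⟩); omega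
        · right; have := ho1 D' (m1.2 ⟨hD', h'⟩); omega
        · have := ho2' D (m2.2 ⟨hD, h⟩) D' (m2.2 ⟨hD', h'⟩) hdis; omega

end Aux

section Aux
open scoped Classical
set_option linter.unusedSectionVars false
variable {V : Type*} [Fintype V]

/-- vertices of `R` with given pattern -/
noncomputable def MC (G : SimpleGraph V) {ι : Type} [Fintype ι] (L : ι → Finset V) (R : Finset V)
    (C : Finset ι) : Finset V := R.filter (fun v => Cv G L v = C)

theorem mem_MC {G : SimpleGraph V} {ι : Type} [Fintype ι] {L : ι → Finset V} {R : Finset V}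
    {C : Finset ι} {v : V} : v ∈ MC G L R C ↔ v ∈ R ∧ Cv G L v = C := by simp [MC]

namespace Ctx
variable {G : SimpleGraph V} {w s : ℕ} {ι : Type} [Fintype ι] {A L0 : Finset V} {L : ι → Finset V}

theorem semi (H : Ctx G w s A L0 L) (hsw : s ≤ 7 * w ^ 3) (R : Finset V)
    (hR : ∀ v ∈ R, Pu G w s L v) (J : Finset (Finset ι)) (hJc : J.card ≤ w)
    (hJ : ∀ C ∈ J, C.Nonempty) (C : Finset ι) (hC : C.Nonempty) (hd : ∀ C' ∈ J, Disjoint C' C) :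
    Semi G (w ^ (s+1)) s (J.biUnion (MC G L R)) (MC G L R C) := by
  intro X' hX' hX'c
  have hw := H.hw
  have hpos : 0 < w ^ s := pwpos hw s
  have key : ∃ C' ∈ J, w ^ s ≤ (X' ∩ MC G L R C').card := by
    by_contra hcon
    push Not at hcon
    have h1 : X' ⊆ J.biUnion (fun C' => X' ∩ MC G L R C') := by
      intro x hx
      obtain ⟨C', h, h'⟩ := Finset.mem_biUnion.1 (hX' hx)
      exact Finset.mem_biUnion.2 ⟨C', h, Finset.mem_inter.2 ⟨hx, h'⟩⟩
    have h2 := Finset.card_le_card h1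
    have h3 := Finset.card_biUnion_le_card_mul J (fun C' => X' ∩ MC G L R C') (w ^ s - 1)
      (fun C' h => by have := hcon C' h; omega)
    have h4 : J.card * (w ^ s - 1) ≤ w * (w ^ s - 1) := Nat.mul_le_mul_right _ hJc
    have h5 : w * (w ^ s - 1) < w * w ^ s := Nat.mul_lt_mul_of_pos_left (by omega) (by omega)
    have h6 : w ^ (s+1) = w * w ^ s := by ring
    omega
  obtain ⟨C', hC', hc⟩ := key
  obtain ⟨T, hT, hTc, hTs⟩ := ramsey G w (by omega) H.cl s _ hc
  refine ⟨T, hT.trans Finset.inter_subset_left, hTc, ?_⟩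
  by_contra hcon
  push Not at hcon
  have hle : w ^ s ≤ w ^ (s+1) := Nat.pow_le_pow_right (by omega) (by omega)
  obtain ⟨T', hT', hTc', hTs'⟩ := ramsey G w (by omega) H.cl s _ (hle.trans hcon)
  obtain ⟨i, hi⟩ := hC
  obtain ⟨j, hj⟩ := hJ C' hC'
  have hdd := hd C' hC'
  have hi' : i ∉ C' := fun h => Finset.disjoint_left.1 hdd h hi
  have hj' : j ∉ C := fun h => Finset.disjoint_left.1 hdd hj h
  refine H.F1 hsw (i := i) (j := j) (fun h => hi' (h ▸ hj)) (T := T) (T' := T') ?_ ?_ hTc hTc' hTs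
    hTs' ?_
  · intro t ht
    have h := mem_MC.1 (Finset.mem_inter.1 (hT ht)).2
    rw [h.2]
    exact ⟨hR t h.1, hi', hj⟩
  · intro t ht
    have h := mem_MC.1 (Finset.mem_filter.1 (hT' ht)).1
    rw [h.2]
    exact ⟨hR t h.1, hj', hi⟩
  · intro x hx y hy
    exact (Finset.mem_filter.1 (hT' hy)).2 x hx

theorem sum_rob (H : Ctx G w s A L0 L) (hsw : s ≤ 7 * w ^ 3) (R : Finset V)
    (hR : ∀ v ∈ R, Pu G w s L v) (a : Finset ι → ℕ)
    (ha : ∀ C, a C ≤ w ∧ Rob G (MC G L R C) (a C) (w ^ (s*s+4*s+3)))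
    (J : Finset (Finset ι)) : J.card ≤ w →
    (∀ C ∈ J, C.Nonempty) → (∀ C ∈ J, ∀ C' ∈ J, C ≠ C' → Disjoint C C') →
    Rob G (J.biUnion (MC G L R)) (∑ C ∈ J, a C) ((w - J.card) * w ^ (s*s+4*s+2)) := by
  have hw := H.hw
  induction J using Finset.induction_on with
  | empty =>
    intro _ _ _ E _
    exact ⟨∅, by simp, by simp [Cl], by simp, by simp⟩
  | insert C J hC ih =>
    intro hc hne hdis
    rw [Finset.card_insert_of_notMem hC] at hc ⊢
    have ih := ih (by omega) (fun D hD => hne D (Finset.mem_insert_of_mem hD))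
      (fun D hD D' hD' => hdis D (Finset.mem_insert_of_mem hD) D' (Finset.mem_insert_of_mem hD'))
    have hd : ∀ C' ∈ J, Disjoint C' C := fun C' h =>
      hdis C' (Finset.mem_insert_of_mem h) C (Finset.mem_insert_self _ _) (fun e => hC (e ▸ h))
    have hsemi := H.semi hsw R hR J (by omega) (fun D hD => hne D (Finset.mem_insert_of_mem hD)) C
      (hne C (Finset.mem_insert_self _ _)) hd
    rw [Finset.biUnion_insert, Finset.sum_insert hC, Finset.union_comm, add_comm (a C)]
    have hqq : (w - (J.card + 1)) * w ^ (s*s+4*s+2) + w ^ (s*s+4*s+2) =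
        (w - J.card) * w ^ (s*s+4*s+2) := by
      rw [show w - J.card = w - (J.card+1) + 1 by omega]; ring
    refine Rob.merge (p := w ^ (s+1)) (s := s) (w := w) ?_ hsemi ih ((ha C).2.mono ?_) ?_ (ha C).1
      (pwpos hw _) (by omega) ?_ ?_
    · rw [Finset.disjoint_left]
      intro x hx hx'
      obtain ⟨C', h, h'⟩ := Finset.mem_biUnion.1 hx
      have e : C' = C := (mem_MC.1 h').2.symm.trans (mem_MC.1 hx').2
      exact hC (e ▸ h)
    · calc _ ≤ w * w ^ (s*s+4*s+2) := Nat.mul_le_mul_right _ (by omega)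
        _ = _ := by ring
    · obtain ⟨K, _, hK, _, hKc⟩ := ih ∅ (by simp)
      rw [← hKc]; exact H.cl K hK
    · have h1 : w ^ (s+1) * w * w = w ^ (s+3) := by ring
      have h2 : w ^ (s+3) ≤ w ^ (s*s+4*s+2) := by
        refine Nat.pow_le_pow_right (by omega) ?_
        have := H.hs
        nlinarith
      rw [h1]; omega
    · have h1 : w ^ (s+1) * (w ^ (s+1) * w * w) ^ s * w = w ^ (s*s+4*s+2) := by
        have : w ^ (s+1) * w * w = w ^ (s+3) := by ring
        rw [this, ← pow_mul, ← pow_add, ← pow_succ]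
        congr 1; ring
      rw [h1]; omega

theorem pure_col (H : Ctx G w s A L0 L) (hsw : s ≤ 7 * w ^ 3) (d D : ℕ) (hd : 1 ≤ d)
    (IH : ∀ (X : Finset V) (a : ℕ), a ≤ w - 1 → (∀ C ⊆ X, Cl G C → C.card ≤ a) → KD G X (a ^ d) D)
    (R0 : Finset V) (hR0 : ∀ v ∈ R0, Pu G w s L v) :
    KD G R0 ((w-1)^d + 1 + w ^ (s+7) + w * w * (2 * w ^ s) + w * w * w ^ (s*s+4*s+3)) D := by
  have hw := H.hw
  obtain ⟨B, hBc, hB⟩ := H.triples hsw R0 hR0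
  set R := R0 \ B with hRdef
  have hR : ∀ v ∈ R, Pu G w s L v := fun v hv => hR0 v (Finset.mem_sdiff.1 hv).1
  set F := R.image (Cv G L) with hFdef
  have hFm : ∀ v ∈ R, Cv G L v ∈ F := fun v hv => Finset.mem_image_of_mem _ hv
  have hFne : ∀ C ∈ F, C.Nonempty := by
    intro C hC
    obtain ⟨v, hv, rfl⟩ := Finset.mem_image.1 hC
    obtain ⟨i, hi⟩ := (hR v hv).non
    exact ⟨i, mem_Cv.2 hi⟩
  have hFlam : ∀ C ∈ F, ∀ C' ∈ F, Lam C C' := by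
    intro C hC C' hC'
    obtain ⟨v, hv, rfl⟩ := Finset.mem_image.1 hC
    obtain ⟨v', hv', rfl⟩ := Finset.mem_image.1 hC'
    exact hB v hv v' hv'
  have hFlt : ∀ C ∈ F, C.card < Fintype.card ι := by
    intro C hC
    obtain ⟨v, hv, rfl⟩ := Finset.mem_image.1 hC
    obtain ⟨i, x, hx, hvx⟩ := (hR v hv).nb
    refine Finset.card_lt_univ_of_notMem (x := i) ?_
    rw [mem_Cv]
    exact fun h => h x hx hvx
  have hk : Fintype.card ι ≤ w := by have := H.T1; omega
  have hFc : F.card ≤ w * w := (lam_card F hFne hFlam hFlt).trans (Nat.mul_le_mul hk hk)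
  -- cliques
  have hcl : ∀ C, ∀ K ⊆ MC G L R C, Cl G K → K.card ≤ w - 1 := by
    intro C K hK hKc
    rcases K.eq_empty_or_nonempty with rfl | ⟨v, hv⟩
    · simp
    have hvM := mem_MC.1 (hK hv)
    obtain ⟨i, x, hx, hvx⟩ := (hR v hvM.1).nb
    have hi : i ∉ C := by
      rw [← hvM.2, mem_Cv]; exact fun h => h x hx hvx
    have hKw := H.cl K hKc
    have hw3 : w ≤ 7 * w ^ 3 := by
      have : w ^ 1 ≤ w ^ 3 := Nat.pow_le_pow_right (by omega) (by omega)
      rw [pow_one] at this; omega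
    have hcom := H.common K (by omega) (fun t ht => hR t (mem_MC.1 (hK ht)).1) (i := i)
      (fun t ht => by rw [(mem_MC.1 (hK ht)).2]; exact hi)
    have hp := pwpos hw (s+5)
    obtain ⟨y, hy⟩ := Finset.card_pos.1 (show 0 < ((L i).filter (fun y => ∀ t ∈ K, G.Adj t y)).card by omega)
    rw [Finset.mem_filter] at hy
    have hyK : y ∉ K := fun h => (hy.2 y h).ne rfl
    have h2 : Cl G (insert y K) := by
      intro a ha b hb hab
      rw [Finset.mem_insert] at ha hb
      rcases ha with rfl | ha <;> rcases hb with rfl | hb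
      · exact absurd rfl hab
      · exact (hy.2 b hb).symm
      · exact hy.2 a ha
      · exact hKc a ha b hb hab
    have h3 := H.cl _ h2
    rw [Finset.card_insert_of_notMem hyK] at h3
    omega
  have hmax := fun C => Rob.exists_max (G := G) (w := w-1) (MC G L R C) (w ^ (s*s+4*s+3)) (hcl C)
  choose a ha1 ha2 E hEc hEcl using hmax
  have hsum : ∀ J ⊆ F, (∀ C ∈ J, ∀ C' ∈ J, C ≠ C' → Disjoint C C') →
      ∑ C ∈ J, a C ^ d ≤ (w-1)^d + 1 := by
    intro J hJF hJd
    refine sum_pow_le' J a d w hd (fun C _ => ha1 C) ?_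
    have hJc : J.card ≤ w := by
      have h1 : J.card ≤ ∑ C ∈ J, C.card := by
        rw [Finset.card_eq_sum_ones]
        exact Finset.sum_le_sum (fun C hC => Finset.card_pos.2 (hFne C (hJF hC)))
      have h2 : (J.biUnion id).card = ∑ C ∈ J, C.card :=
        Finset.card_biUnion (fun C hC C' hC' h => hJd C hC C' hC' h)
      have h3 : (J.biUnion id).card ≤ Fintype.card ι := Finset.card_le_univ _
      omega
    obtain ⟨K, _, hK, _, hKc⟩ := H.sum_rob hsw R hR a
      (fun C => ⟨(ha1 C).trans (by omega), ha2 C⟩) J hJc (fun C hC => hFne C (hJF hC)) hJd ∅ (by simp)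
    rw [← hKc]; exact H.cl K hK
  obtain ⟨o, ho1, ho2⟩ := lam_offset (fun C => a C ^ d) F.card F le_rfl hFne hFlam _ hsum
  have hcol := fun C => IH (MC G L R C \ E C) (a C) (ha1 C) (hEcl C)
  choose fC hf1 hf2 using hcol
  set Rich := R.filter (fun v => v ∉ E (Cv G L v) ∧
    2 * w ^ s ≤ ((MC G L R (Cv G L v)).filter (fun x => G.Adj v x)).card) with hRich
  have mR : ∀ {v}, v ∈ Rich → v ∈ R ∧ v ∉ E (Cv G L v) ∧
    2 * w ^ s ≤ ((MC G L R (Cv G L v)).filter (fun x => G.Adj v x)).card := by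
    intro v hv; simpa [hRich] using hv
  have hfv : ∀ v ∈ Rich, fC (Cv G L v) v < a (Cv G L v) ^ d := fun v hv =>
    hf1 _ v (Finset.mem_sdiff.2 ⟨mem_MC.2 ⟨(mR hv).1, rfl⟩, (mR hv).2.1⟩)
  have hrich : KD G Rich ((w-1)^d+1) D := by
    refine ⟨fun v => o (Cv G L v) + fC (Cv G L v) v, ?_, ?_⟩
    · intro v hv
      have h1 := hfv v hv
      have h2 := ho1 _ (hFm v (mR hv).1)
      simp only at h2 ⊢
      omega
    · intro i S hS ⟨v0, hv0⟩
      have hS' : ∀ v ∈ S, v ∈ Rich ∧ o (Cv G L v) + fC (Cv G L v) v = i := by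
        intro v hv; simpa using hS hv
      set C0 := Cv G L v0 with hC0
      have hsub : S.filter (fun v => Cv G L v = C0) ⊆
          (MC G L R C0 \ E C0).filter (fun v => fC C0 v = i - o C0) := by
        intro v hv
        rw [Finset.mem_filter] at hv
        obtain ⟨hvS, hvC⟩ := hv
        obtain ⟨h1, h2⟩ := hS' v hvS
        have h3 := (mR h1).2.1
        rw [hvC] at h2 h3
        rw [Finset.mem_filter, Finset.mem_sdiff]
        exact ⟨⟨mem_MC.2 ⟨(mR h1).1, hvC⟩, h3⟩, by omega⟩
      obtain ⟨v, hv, hvd⟩ := hf2 C0 _ _ hsub ⟨v0, Finset.mem_filter.2 ⟨hv0, rfl⟩⟩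
      rw [Finset.mem_filter] at hv
      refine ⟨v, hv.1, (Finset.card_le_card ?_).trans hvd⟩
      intro u hu
      rw [Finset.mem_filter] at hu
      rw [Finset.mem_filter, Finset.mem_filter]
      refine ⟨⟨hu.1, ?_⟩, hu.2⟩
      by_contra hne
      rw [← hv.2] at hne
      obtain ⟨hvR, hvi⟩ := hS' v hv.1
      obtain ⟨huR, hui⟩ := hS' u hu.1
      have gv := hfv v hvR
      have gu := hfv u huR
      have nbr : ∀ z ∈ Rich, ∀ x ∈ (MC G L R (Cv G L z)).filter (fun x => G.Adj z x),
          G.Adj z x ∧ Pu G w s L x ∧ Cv G L x = Cv G L z := by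
        intro z _ x hx
        rw [Finset.mem_filter, mem_MC] at hx
        exact ⟨hx.2, hR x hx.1.1, hx.1.2⟩
      rcases hFlam _ (hFm v (mR hvR).1) _ (hFm u (mR huR).1) with h | h | h
      · exact H.F3 (hR u (mR huR).1) (hR v (mR hvR).1) (Finset.ssubset_iff_subset_ne.2 ⟨h, Ne.symm hne⟩)
          _ (nbr u huR) (mR huR).2.2 hu.2.symm
      · exact H.F3 (hR v (mR hvR).1) (hR u (mR huR).1) (Finset.ssubset_iff_subset_ne.2 ⟨h, hne⟩)
          _ (nbr v hvR) (mR hvR).2.2 hu.2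
      · have := ho2 _ (hFm v (mR hvR).1) _ (hFm u (mR huR).1) h
        omega
  have hps := pwpos hw s
  have hsparse : KD G (F.biUnion (fun C => (MC G L R C).filter (fun v =>
      ((MC G L R C).filter (fun x => G.Adj v x)).card < 2 * w ^ s))) (F.card * (2 * w ^ s)) D := by
    refine KD.biUnion F _ (fun C _ => ?_)
    have h1 : Dg G ((MC G L R C).filter (fun v =>
      ((MC G L R C).filter (fun x => G.Adj v x)).card < 2 * w ^ s)) (2 * w ^ s - 1) := by
      intro S hS ⟨v, hv⟩
      refine ⟨v, hv, ?_⟩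
      have h2 := (Finset.mem_filter.1 (hS hv)).2
      have h3 := Finset.card_le_card (Finset.filter_subset_filter (fun u => G.Adj v u)
        (hS.trans (Finset.filter_subset _ _)))
      omega
    have := KD.of_Dg D h1
    rwa [show 2 * w ^ s - 1 + 1 = 2 * w ^ s by omega] at this
  have hexc : KD G (F.biUnion E) (F.card * w ^ (s*s+4*s+3)) D :=
    KD.biUnion F _ (fun C _ => (KD.of_card D (E C)).mono (Finset.Subset.refl _) (hEc C))
  have hB' : KD G B (w ^ (s+7)) D := (KD.of_card D B).mono (Finset.Subset.refl _) hBc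
  refine (((hrich.union hB').union hsparse).union hexc).mono ?_ ?_
  · intro v hv
    simp only [Finset.mem_union, Finset.mem_biUnion]
    by_cases hvB : v ∈ B
    · exact Or.inl (Or.inl (Or.inr hvB))
    have hvR : v ∈ R := Finset.mem_sdiff.2 ⟨hv, hvB⟩
    by_cases hvE : v ∈ E (Cv G L v)
    · exact Or.inr ⟨_, hFm v hvR, hvE⟩
    by_cases hvr : 2 * w ^ s ≤ ((MC G L R (Cv G L v)).filter (fun x => G.Adj v x)).card
    · exact Or.inl (Or.inl (Or.inl (Finset.mem_filter.2 ⟨hvR, hvE, hvr⟩)))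
    · exact Or.inl (Or.inr ⟨_, hFm v hvR, Finset.mem_filter.2 ⟨mem_MC.2 ⟨hvR, rfl⟩, by omega⟩⟩)
  · have e1 := Nat.mul_le_mul_right (2 * w ^ s) hFc
    have e2 := Nat.mul_le_mul_right (w ^ (s*s+4*s+3)) hFc
    omega

end Ctx
end Aux

section Aux
open scoped Classical
set_option linter.unusedSectionVars false
variable {V : Type*} [Fintype V]

theorem part1_arith (w s c : ℕ) (hw : 200 ≤ w) (hs : 1 ≤ s) (hc : 2 * s ≤ c) :
    1 + w ^ (s+7) + w * w * (2 * w ^ s) + w * w * w ^ (s*s+4*s+3) + (14 * w ^ (s+7) + w) +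
      w ^ ((2*s+1)*(s+7) - 1) + 14 * w ^ (s+7) * (14 * w ^ (s+6)) ^ c ≤ w ^ ((c+1)*(s+7)) := by
  set m := (2*s+1)*(s+7) - 1 with hm
  have hm1 : m + 1 = (2*s+1)*(s+7) := by
    have : 0 < (2*s+1)*(s+7) := by positivity
    omega
  have hm2 : m + 1 = 2*(s*s) + 15*s + 7 := by rw [hm1]; ring
  have hss : 1 ≤ s * s := Nat.mul_pos hs hs
  have pw : ∀ n, n ≤ m → w ^ n ≤ w ^ m := fun n h => Nat.pow_le_pow_right (by omega) h
  have h1 : 1 ≤ w ^ m := Nat.one_le_pow _ _ (by omega)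
  have h2 : w ^ (s+7) ≤ w ^ m := pw _ (by omega)
  have h3 : w * w * (2 * w ^ s) ≤ 2 * w ^ m := by
    calc _ = 2 * w ^ (s+2) := by ring
      _ ≤ _ := Nat.mul_le_mul_left _ (pw _ (by omega))
  have h4 : w * w * w ^ (s*s+4*s+3) ≤ w ^ m := by
    calc _ = w ^ (s*s+4*s+5) := by ring
      _ ≤ _ := pw _ (by omega)
  have h5 : w ≤ w ^ m := by
    calc w = w ^ 1 := by ring
      _ ≤ _ := pw _ (by omega)
  have h6 : 200 * w ^ m ≤ w ^ ((c+1)*(s+7)) := by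
    calc 200 * w ^ m ≤ w * w ^ m := Nat.mul_le_mul_right _ hw
      _ = w ^ (m+1) := by ring
      _ ≤ _ := by
        refine Nat.pow_le_pow_right (by omega) ?_
        rw [hm1]; exact Nat.mul_le_mul_right _ (by omega)
  have h7 : 14 * (14 * w ^ (s+7) * (14 * w ^ (s+6)) ^ c) ≤ w ^ ((c+1)*(s+7)) := by
    have e1 : 14 * (14 * w ^ (s+7) * (14 * w ^ (s+6)) ^ c) = 14 ^ (c+2) * w ^ (s+7+(s+6)*c) := by
      rw [mul_pow, ← pow_mul, pow_add w (s+7)]; ring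
    have e2 : (14:ℕ) ^ (c+2) ≤ w ^ c := by
      calc (14:ℕ) ^ (c+2) ≤ 14 ^ (2*c) := Nat.pow_le_pow_right (by omega) (by omega)
        _ = 196 ^ c := by rw [pow_mul]; norm_num
        _ ≤ _ := Nat.pow_le_pow_left (by omega) _
    rw [e1]
    calc _ ≤ w ^ c * w ^ (s+7+(s+6)*c) := Nat.mul_le_mul_right _ e2
      _ = _ := by rw [← pow_add]; congr 1; ring
  omega

namespace Ctx
variable {G : SimpleGraph V} {w s : ℕ} {ι : Type} [Fintype ι] {A L0 : Finset V} {L : ι → Finset V}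

theorem part1 (H : Ctx G w s A L0 L) (hw : 200 ≤ w) (hsw : s ≤ 7 * w ^ 3) (d D c : ℕ) (hd : 1 ≤ d)
    (hc : 2 * s ≤ c)
    (IH : ∀ (X : Finset V) (a : ℕ), a ≤ w - 1 → (∀ C ⊆ X, Cl G C → C.card ≤ a) → KD G X (a ^ d) D)
    (KST : ∀ (X : Finset V) (t : ℕ), (∃ P Q : Finset V, P ⊆ X ∧ Q ⊆ X ∧ P.card = t ∧ Q.card = t ∧
      Disjoint P Q ∧ ∀ x ∈ P, ∀ y ∈ Q, G.Adj x y) ∨ ∃ e < t ^ c, Dg G X e)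
    (R : Finset V) (hRA : R ⊆ A) (hRL : ∀ v ∈ R, ∀ i, v ∉ L i)
    (hRn : ∀ v ∈ R, ∃ i, ∃ x ∈ L i, G.Adj v x) :
    KD G (L0 ∪ Finset.univ.biUnion L ∪ R) ((w-1)^d + w ^ ((c+1)*(s+7))) D := by
  set U := Finset.univ.biUnion L with hU
  set dn : V → V → Prop := fun u v => ∃ j, u ∈ L j ∧ ∀ i, i ≠ j →
      14 * ((L i).filter (fun x => G.Adj u x ∧ ¬ G.Adj v x)).card < w ^ (s+2) with hdn
  set P := R.filter (fun v => Pend G s L v) with hP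
  set R0 := R.filter (fun v => ¬ Pend G s L v ∧ ∀ u ∈ U, ¬ dn u v) with hR0
  have hUc : U.card ≤ 14 * w ^ (s+7) := H.LU_card
  have hPc : P.card ≤ w ^ ((2*s+1)*(s+7) - 1) := H.pend_card P
    (fun v hv => (Finset.mem_filter.1 hv).2) (fun v hv => hRL v (Finset.mem_filter.1 hv).1)
  have hpu : ∀ v ∈ R0, Pu G w s L v := by
    intro v hv
    obtain ⟨h1, h2, h3⟩ := Finset.mem_filter.1 hv
    have h4 := H.pure hw h2 (by
      intro j u hu
      have h5 := h3 u (Finset.mem_biUnion.2 ⟨j, Finset.mem_univ _, hu⟩)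
      by_contra hcon
      push Not at hcon
      exact h5 ⟨j, hu, hcon⟩)
    obtain ⟨⟨i, _, _, hi, _⟩, hpur⟩ := h4
    exact ⟨hRL v h1, hRn v h1, ⟨i, hi⟩, hpur⟩
  have k1 := H.pure_col hsw d D hd IH R0 hpu
  have k2 : KD G (U.biUnion (fun u => R.filter (dn u))) (U.card * (14 * w ^ (s+6)) ^ c) D := by
    refine KD.biUnion U _ (fun u hu => ?_)
    rcases KST (R.filter (dn u)) (14 * w ^ (s+6)) with ⟨P, Q, hPX, hQX, hPc, hQc, hPQ, hadj⟩ | ⟨e, he, hDg⟩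
    · exfalso
      obtain ⟨j, -, hj⟩ := Finset.mem_biUnion.1 hu
      have hX : ∀ b : Bool, (if b then P else Q) ⊆ R.filter (dn u) := by
        intro b; cases b
        · simpa using hQX
        · simpa using hPX
      refine H.T5 hj (fun b => if b then P else Q) ?_ ?_ ?_ ?_ ?_ ?_
      · intro b
        exact (hX b).trans ((Finset.filter_subset _ _).trans hRA)
      · intro b i
        rw [Finset.disjoint_left]
        intro x hx hx'
        exact hRL x (Finset.mem_filter.1 (hX b hx')).1 i hx
      · intro b; cases b
        · simpa using hQc
        · simpa using hPc
      · simpa using hPQ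
      · simpa using hadj
      · intro b v hv i hij
        obtain ⟨j', hj', h⟩ := (Finset.mem_filter.1 (hX b hv)).2
        have : j' = j := by
          by_contra hne
          exact Finset.disjoint_left.1 (H.T.dj _ _ hne) hj' hj
        subst this
        have h1 := h i hij
        have h2 : nn G v ((L i).filter (fun x => G.Adj u x)) =
            (L i).filter (fun x => G.Adj u x ∧ ¬ G.Adj v x) := by
          ext x; simp [mem_nn, and_assoc]
        rw [h2]; omega
    · exact (KD.of_Dg D hDg).mono (Finset.Subset.refl _) he
  have k3 : KD G (L0 ∪ U) (w + 14 * w ^ (s+7)) D :=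
    ((KD.of_card D L0).union (KD.of_card D U)).mono (Finset.Subset.refl _)
      (by have := H.T1; omega)
  have k4 : KD G P _ D := (KD.of_card D P).mono (Finset.Subset.refl _) hPc
  refine (((k1.union k3).union k4).union k2).mono ?_ ?_
  · intro v hv
    rw [Finset.mem_union] at hv
    simp only [Finset.mem_union, Finset.mem_biUnion]
    rcases hv with hv | hv
    · rw [Finset.mem_union] at hv
      exact Or.inl (Or.inl (Or.inr hv))
    · by_cases h1 : Pend G s L v
      · exact Or.inl (Or.inr (Finset.mem_filter.2 ⟨hv, h1⟩))
      by_cases h2 : ∃ u ∈ U, dn u v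
      · obtain ⟨u, hu, h⟩ := h2
        exact Or.inr ⟨u, hu, Finset.mem_filter.2 ⟨hv, h⟩⟩
      · push Not at h2
        exact Or.inl (Or.inl (Or.inl (Finset.mem_filter.2 ⟨hv, h1, h2⟩)))
  · have e1 := Nat.mul_le_mul_right ((14 * w ^ (s+6)) ^ c) hUc
    have e2 := part1_arith w s c hw H.hs hc
    omega

end Ctx
end Aux

section Aux
open scoped Classical
set_option linter.unusedSectionVars false
variable {V : Type*} [Fintype V]

theorem Dg_of_deg {W : Type*} {K : SimpleGraph W} {G : SimpleGraph V} (ψ : K ↪g G) (X : Finset V)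
    (hX : ∀ x ∈ X, ∃ a, ψ a = x) {D : ℕ} (h : DegeneracyAtMost K D) : Dg G X D := by
  intro S hS ⟨x, hx⟩
  obtain ⟨a, ha⟩ := hX x (hS hx)
  obtain ⟨b, hb, hbD⟩ := h ((⊤ : K.Subgraph).induce {y | ψ y ∈ S}) ⟨a, by simpa [ha] using hx⟩
  have hb' : ψ b ∈ S := hb
  refine ⟨ψ b, hb', ?_⟩
  have hfin : Finite W := Finite.of_injective ψ ψ.injective
  have h1 : (((⊤ : K.Subgraph).induce {y | ψ y ∈ S}).neighborSet b) = {y | ψ y ∈ S ∧ K.Adj b y} := by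
    ext y
    simp [hb']
  rw [h1] at hbD
  have h2 : ((S.filter (fun u => G.Adj (ψ b) u) : Finset V) : Set V) =
      ψ '' {y | ψ y ∈ S ∧ K.Adj b y} := by
    ext u
    simp only [Finset.coe_filter, Set.mem_ofPred_eq, Set.mem_image]
    constructor
    · rintro ⟨hu, hbu⟩
      obtain ⟨y, rfl⟩ := hX u (hS hu)
      exact ⟨y, ⟨hu, ψ.map_adj_iff.1 hbu⟩, rfl⟩
    · rintro ⟨y, ⟨hy, hby⟩, rfl⟩
      exact ⟨hy, ψ.map_adj_iff.2 hby⟩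
  rw [← Set.ncard_coe_finset, h2, Set.ncard_image_of_injective _ ψ.injective]
  exact hbD

theorem deg_of_Dg {W : Type*} {K : SimpleGraph W} {G : SimpleGraph V} (ψ : K ↪g G) (X : Finset V)
    (hX : ∀ a, ψ a ∈ X) {D : ℕ} (h : Dg G X D) : DegeneracyAtMost K D := by
  intro Q ⟨a, ha⟩
  obtain ⟨x, hx, hxD⟩ := h (Finset.univ.filter (fun x => ∃ b ∈ Q.verts, ψ b = x)) (by
    intro x hx
    obtain ⟨b, _, rfl⟩ := (Finset.mem_filter.1 hx).2
    exact hX b) ⟨ψ a, by simpa using ha⟩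
  obtain ⟨b, hb, rfl⟩ := (Finset.mem_filter.1 hx).2
  refine ⟨b, hb, ?_⟩
  rw [← Set.ncard_image_of_injective _ ψ.injective]
  rw [← Set.ncard_coe_finset] at hxD
  refine (Set.ncard_le_ncard ?_ (Finset.finite_toSet _)).trans hxD
  rintro _ ⟨y, hy, rfl⟩
  have hy' : Q.Adj b y := hy
  simp only [Finset.coe_filter, Set.mem_ofPred_eq, Finset.mem_filter, Finset.mem_univ, true_and]
  exact ⟨⟨y, Q.edge_vert hy'.symm, rfl⟩, ψ.map_adj_iff.2 (Q.adj_sub hy')⟩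

theorem free_of_emb {W U : Type*} {K : SimpleGraph W} {G : SimpleGraph V} (ψ : K ↪g G)
    (H : SimpleGraph U) (h : IsInducedFree G H) : IsInducedFree K H := by
  rintro S ⟨e⟩
  refine h (ψ '' S) ⟨RelIso.trans (RelIso.symm ?_) e⟩
  refine ⟨Equiv.Set.image ψ S ψ.injective, ?_⟩
  intro a b
  exact ψ.map_adj_iff

theorem clique_of_emb {W : Type*} [Finite W] {K : SimpleGraph W} {G : SimpleGraph V} (ψ : K ↪g G)
    (X : Finset V) (hX : ∀ a, ψ a ∈ X) {m : ℕ} (h : ∀ C ⊆ X, Cl G C → C.card ≤ m) :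
    K.cliqueNum ≤ m := by
  have : Fintype W := Fintype.ofFinite W
  obtain ⟨C, hC⟩ := K.exists_isNClique_cliqueNum
  rw [← hC.card_eq, ← Finset.card_map ψ.toEmbedding]
  refine h _ ?_ ?_
  · intro x hx
    obtain ⟨a, _, rfl⟩ := Finset.mem_map.1 hx
    exact hX a
  · intro x hx y hy hxy
    obtain ⟨a, ha, rfl⟩ := Finset.mem_map.1 hx
    obtain ⟨b, hb, rfl⟩ := Finset.mem_map.1 hy
    exact ψ.map_adj_iff.2 (hC.isClique ha hb (fun e => hxy (by rw [e])))

/-- the graph on `Fin n` isomorphic to `G[X]` -/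
theorem exists_model (G : SimpleGraph V) (X : Finset V) : ∃ (K : SimpleGraph (Fin X.card))
    (ψ : K ↪g G), (∀ a, ψ a ∈ X) ∧ ∀ x ∈ X, ∃ a, ψ a = x := by
  let φ : Fin X.card ↪ V := X.equivFin.symm.toEmbedding.trans (Function.Embedding.subtype _)
  refine ⟨G.comap φ, SimpleGraph.Embedding.comap φ G, ?_, ?_⟩
  · intro a
    exact (X.equivFin.symm a).2
  · intro x hx
    refine ⟨X.equivFin ⟨x, hx⟩, ?_⟩
    show ((X.equivFin.symm (X.equivFin ⟨x, hx⟩) : X) : V) = x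
    simp

theorem KD_of_col {W : Type*} {K : SimpleGraph W} {G : SimpleGraph V} (ψ : K ↪g G) (X : Finset V)
    (hX : ∀ x ∈ X, ∃ a, ψ a = x) {n D : ℕ} (h : KDColorable K n D) : KD G X n D := by
  obtain ⟨f, hf⟩ := h
  have hinv : ∀ x, ∃ m : ℕ, ∀ a, ψ a = x → m = f a := by
    intro x
    by_cases h : ∃ a, ψ a = x
    · obtain ⟨a, ha⟩ := h
      refine ⟨f a, fun b hb => ?_⟩
      rw [ψ.injective (ha.trans hb.symm)]
    · exact ⟨0, fun a ha => absurd ⟨a, ha⟩ h⟩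
  choose g hg using hinv
  refine ⟨g, ?_, ?_⟩
  · intro x hx
    obtain ⟨a, ha⟩ := hX x hx
    rw [hg x a ha]; exact (f a).2
  · intro i
    by_cases hi : i < n
    · refine Dg_of_deg ((SimpleGraph.Embedding.induce {v | f v = ⟨i, hi⟩}).trans ψ) _ ?_ (hf ⟨i, hi⟩)
      intro x hx
      rw [Finset.mem_filter] at hx
      obtain ⟨a, ha⟩ := hX x hx.1
      have h1 := hg x a ha
      refine ⟨⟨a, ?_⟩, ha⟩
      show f a = ⟨i, hi⟩
      ext
      simp only
      omega
    · intro S hS ⟨x, hx⟩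
      have := Finset.mem_filter.1 (hS hx)
      obtain ⟨a, ha⟩ := hX x this.1
      have h1 := hg x a ha
      have h2 := (f a).2
      omega

theorem col_of_KD {W : Type*} {K : SimpleGraph W} {G : SimpleGraph V} (ψ : K ↪g G) (X : Finset V)
    (hX : ∀ a, ψ a ∈ X) {n D : ℕ} (h : KD G X n D) : KDColorable K n D := by
  obtain ⟨f, hf1, hf2⟩ := h
  refine ⟨fun a => ⟨f (ψ a), hf1 _ (hX a)⟩, fun i => ?_⟩
  refine deg_of_Dg ((SimpleGraph.Embedding.induce _).trans ψ) _ ?_ (hf2 i)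
  rintro ⟨a, ha⟩
  refine Finset.mem_filter.2 ⟨hX a, ?_⟩
  exact congrArg Fin.val ha

theorem ncard_nn (G : SimpleGraph V) (v : V) (S : Finset V) :
    ({u ∈ (S : Set V) | ¬ G.Adj v u}).ncard = (nn G v S).card := by
  rw [← Set.ncard_coe_finset]; congr 1; ext; simp [mem_nn]

theorem isTemplate_iff (G : SimpleGraph V) (s k : ℕ) (K : Finset V) (M : Fin k → Finset V) :
    IsTemplate G s (K : Set V) (fun i => (M i : Set V)) ↔ Tpl G G.cliqueNum s K M := by
  unfold IsTemplate
  simp only [ncard_nn, Set.ncard_coe_finset, Finset.disjoint_coe]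
  constructor
  · rintro ⟨h1, h2, h3, h4, h5, h6⟩
    exact ⟨fun a ha b hb hab => h3 ha hb hab, h4, fun i j hij => h2 hij, fun i => (h5 i).1,
      fun i => (h5 i).2, h6⟩
  · intro h
    refine ⟨?_, fun i j hij => h.dj i j hij, fun a ha b hb hab => h.cl0 a ha b hb hab, h.com,
      fun i => ⟨h.lo i, h.hi i⟩, h.few⟩
    intro i
    rw [Finset.disjoint_left]
    intro x hx hx'
    exact (h.com x hx i x hx').ne rfl

theorem templateValue_eq (G : SimpleGraph V) (s k : ℕ) (K : Finset V) (M : Fin k → Finset V)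
    (hd : ∀ i j, i ≠ j → Disjoint (M i) (M j)) :
    templateValue G s (K : Set V) (fun i => (M i : Set V)) = tval G.cliqueNum s K M := by
  unfold templateValue tval
  have : (⋃ i, (M i : Set V)) = ((Finset.univ.biUnion M : Finset V) : Set V) := by
    ext; simp
  rw [this, Set.ncard_coe_finset, Set.ncard_coe_finset,
    Finset.card_biUnion (fun i _ j _ h => hd i j h), Fintype.card_fin]

theorem mkCtx (G : SimpleGraph V) (s : ℕ) (hs : 1 ≤ s)
    (hfree : IsInducedFree G (doubleStarGraph s)) (hw : 15 ≤ G.cliqueNum)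
    (A L0 : Finset V) (k : ℕ) (L : Fin k → Finset V)
    (hT : IsTemplate G s (L0 : Set V) (fun i => (L i : Set V)))
    (hsub : templateVerts (L0 : Set V) (fun i => (L i : Set V)) ⊆ (A : Set V))
    (hval : 28 * G.cliqueNum ^ (s+6) ≤ templateValue G s (L0 : Set V) (fun i => (L i : Set V)))
    (hopt : ∀ (k' : ℕ) (L0' : Set V) (L' : Fin k' → Set V), IsTemplate G s L0' L' →
      templateVerts L0' L' ⊆ (A : Set V) →
      templateValue G s L0' L' ≤ templateValue G s (L0 : Set V) (fun i => (L i : Set V))) :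
    Ctx G G.cliqueNum s A L0 L := by
  have hT' := (isTemplate_iff G s k L0 L).1 hT
  rw [templateValue_eq G s k L0 L hT'.dj] at hval
  refine ⟨hs, hw, ?_, noDS_of_free G s hfree, hT', ?_, ?_, ?_, hval⟩
  · intro C hC
    exact SimpleGraph.IsClique.card_le_cliqueNum (G := G) (t := C)
      (tc := fun a ha b hb hab => hC a ha b hb hab)
  · intro x hx
    exact hsub (Or.inl hx)
  · intro i x hx
    exact hsub (Or.inr (Set.mem_iUnion.2 ⟨i, hx⟩))
  · intro κ _ K M hM hKA hMA
    let e := Fintype.equivFin κ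
    have hT2 : Tpl G G.cliqueNum s K (fun i => M (e.symm i)) :=
      ⟨hM.cl0, fun u hu i => hM.com u hu _, fun i j hij => hM.dj _ _ (fun h => hij (e.symm.injective h)),
        fun i => hM.lo _, fun i => hM.hi _,
        fun i j hij => hM.few _ _ (fun h => hij (e.symm.injective h))⟩
    have h1 := hopt _ (K : Set V) (fun i => (M (e.symm i) : Set V))
      ((isTemplate_iff G s _ K (fun i => M (e.symm i))).2 hT2) (by
        rintro x (hx | hx)
        · exact hKA hx
        · obtain ⟨i, hi⟩ := Set.mem_iUnion.1 hx
          exact hMA _ hi)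
    rw [templateValue_eq G s k L0 L hT'.dj,
      templateValue_eq G s _ K (fun i => M (e.symm i)) hT2.dj] at h1
    have h2 : tval G.cliqueNum s K (fun i => M (e.symm i)) = tval G.cliqueNum s K M := by
      unfold tval
      rw [Fintype.card_fin, Equiv.sum_comp e.symm (fun i => (M i).card)]
    omega

end Aux

/-- The localized version: let `A ⊆ V(G)` and let `𝓛` be an `s`-template with `V(𝓛) ⊆ A`, of
value at least `28 ω^{s+6}`, chosen of maximum value among all such templates. Then (1) under
the inductive colourability hypothesis and the Kővári–Sós–Turán-type bound,
`V(𝓛) ∪ N_A(𝓛)` is `((ω−1)^d + ω^{(c+1)(s+7)}, D)`-colourable; and (2) if `ω ≥ 15` and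
`ω² > s+1`, every vertex of `Y_A(𝓛)` has at most `ω^{s+7}` neighbours in `A \ Y_A(𝓛)`. -/
theorem template_local {V : Type*} [Fintype V] (G : SimpleGraph V) (s : ℕ) (hs : 1 ≤ s)
    (hfree : IsInducedFree G (doubleStarGraph s))
    (A : Set V) (L0 : Set V) (k : ℕ) (L : Fin k → Set V)
    (hT : IsTemplate G s L0 L) (hsub : templateVerts L0 L ⊆ A)
    (hval : 28 * G.cliqueNum ^ (s+6) ≤ templateValue G s L0 L)
    (hopt : ∀ (k' : ℕ) (L0' : Set V) (L' : Fin k' → Set V), IsTemplate G s L0' L' →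
      templateVerts L0' L' ⊆ A → templateValue G s L0' L' ≤ templateValue G s L0 L) :
    ((∀ (d D : ℕ), 1 ≤ d →
      (∀ (W : Type) [Fintype W], ∀ G' : SimpleGraph W,
        IsInducedFree G' (doubleStarGraph s) → G'.cliqueNum < G.cliqueNum →
        KDColorable G' (G'.cliqueNum ^ d) D) →
      ∀ c : ℕ, 2 * s ≤ c → KSTBound s c →
      7 * G.cliqueNum ^ 3 > 7 * G.cliqueNum + s → 200 ≤ G.cliqueNum →
      KDColorable (G.induce (templateVerts L0 L ∪ templateNbhdIn G A L0 L))
        ((G.cliqueNum - 1) ^ d + G.cliqueNum ^ ((c+1) * (s+7))) D)) ∧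
    (15 ≤ G.cliqueNum → s + 1 < G.cliqueNum ^ 2 →
      ∀ v ∈ templateYIn G s A L0 L,
        ({u ∈ A | u ∉ templateYIn G s A L0 L ∧ G.Adj v u}).ncard
          ≤ G.cliqueNum ^ (s+7)) := by
  classical
  obtain ⟨A, rfl⟩ : ∃ F : Finset V, (F : Set V) = A := ⟨A.toFinset, by simp⟩
  obtain ⟨L0, rfl⟩ : ∃ F : Finset V, (F : Set V) = L0 := ⟨L0.toFinset, by simp⟩
  obtain ⟨L, rfl⟩ : ∃ F : Fin k → Finset V, (fun i => (F i : Set V)) = L :=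
    ⟨fun i => (L i).toFinset, by simp⟩
  constructor
  · intro d D hd hIH c hc hKST hw3 hw
    have H := mkCtx G s hs hfree (by omega) A L0 k L hT hsub hval hopt
    set R := A.filter (fun v => (v ∉ L0 ∧ ∀ i, v ∉ L i) ∧ ∃ i, ∃ u ∈ L i, G.Adj v u) with hR
    have hK := H.part1 hw (by omega) d D c hd hc ?_ ?_ R (Finset.filter_subset _ _)
      (fun v hv => (Finset.mem_filter.1 hv).2.1.2) (fun v hv => (Finset.mem_filter.1 hv).2.2)
    · refine col_of_KD (SimpleGraph.Embedding.induce _) _ ?_ hK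
      rintro ⟨v, hv⟩
      show v ∈ _
      simp only [Finset.mem_union, Finset.mem_biUnion, Finset.mem_univ, true_and]
      rcases hv with (hv | hv) | hv
      · exact Or.inl (Or.inl hv)
      · obtain ⟨i, hi⟩ := Set.mem_iUnion.1 hv
        exact Or.inl (Or.inr ⟨i, hi⟩)
      · obtain ⟨h1, h2, h3⟩ := hv
        refine Or.inr (Finset.mem_filter.2 ⟨h1, ⟨fun h => h2 (Or.inl h), fun i h => h2 (Or.inr ?_)⟩, h3⟩)
        exact Set.mem_iUnion.2 ⟨i, h⟩
    · intro X a ha hcl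
      obtain ⟨K, ψ, hψ1, hψ2⟩ := exists_model G X
      have h1 : K.cliqueNum ≤ a := clique_of_emb ψ X hψ1 hcl
      have h2 := hIH _ K (free_of_emb ψ _ hfree) (by omega)
      exact (KD_of_col ψ X hψ2 h2).mono (Finset.Subset.refl _) (Nat.pow_le_pow_left h1 d)
    · intro X t
      obtain ⟨K, ψ, hψ1, hψ2⟩ := exists_model G X
      rcases hKST _ K (free_of_emb ψ _ hfree) t with ⟨P, Q, hP, hQ, hPQ, hadj⟩ | ⟨e, he, hdeg⟩
      · left
        refine ⟨P.map ψ.toEmbedding, Q.map ψ.toEmbedding, ?_, ?_, by simpa using hP,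
          by simpa using hQ, (Finset.disjoint_map _).2 hPQ, ?_⟩
        · intro x hx
          obtain ⟨a, _, rfl⟩ := Finset.mem_map.1 hx
          exact hψ1 a
        · intro x hx
          obtain ⟨a, _, rfl⟩ := Finset.mem_map.1 hx
          exact hψ1 a
        · intro x hx y hy
          obtain ⟨a, ha, rfl⟩ := Finset.mem_map.1 hx
          obtain ⟨b, hb, rfl⟩ := Finset.mem_map.1 hy
          exact ψ.map_adj_iff.2 (hadj a ha b hb)
      · exact Or.inr ⟨e, he, Dg_of_deg ψ X hψ2 hdeg⟩
  · intro hw _ v hv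
    have H := mkCtx G s hs hfree hw A L0 k L hT hsub hval hopt
    have hV : ∀ u, u ∈ templateVerts (L0 : Set V) (fun i => (L i : Set V)) ↔
        u ∈ L0 ∨ ∃ i, u ∈ L i := by
      intro u; simp [templateVerts]
    have hN : ∀ u, u ∈ templateNbhdIn G (A : Set V) (L0 : Set V) (fun i => (L i : Set V)) ↔
        u ∈ A ∧ ¬ (u ∈ L0 ∨ ∃ i, u ∈ L i) ∧ ∃ i, ∃ x ∈ L i, G.Adj u x := by
      intro u; rw [← hV]; rfl
    have hZ : ∀ u, u ∈ templateZIn G s (A : Set V) (L0 : Set V) (fun i => (L i : Set V)) ↔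
        u ∈ L0 ∨ (u ∈ A ∧ ¬ (u ∈ L0 ∨ ∃ i, u ∈ L i) ∧
          ∀ i, 4 * (nn G u (L i)).card ≤ G.cliqueNum ^ (s+2)) := by
      intro u; rw [← hV]; simp only [← ncard_nn]; rfl
    have hY : ∀ u, u ∈ templateYIn G s (A : Set V) (L0 : Set V) (fun i => (L i : Set V)) ↔
        ((u ∈ L0 ∨ ∃ i, u ∈ L i) ∨ (u ∈ A ∧ ¬ (u ∈ L0 ∨ ∃ i, u ∈ L i) ∧ ∃ i, ∃ x ∈ L i, G.Adj u x)) ∧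
        ¬ (u ∈ L0 ∨ (u ∈ A ∧ ¬ (u ∈ L0 ∨ ∃ i, u ∈ L i) ∧
          ∀ i, 4 * (nn G u (L i)).card ≤ G.cliqueNum ^ (s+2))) := by
      intro u; rw [← hN, ← hZ, ← hV]; rfl
    rw [hY] at hv
    have hX : {u ∈ (A : Set V) | u ∉ templateYIn G s (A : Set V) (L0 : Set V)
        (fun i => (L i : Set V)) ∧ G.Adj v u} =
        ((A.filter (fun u => u ∉ templateYIn G s (A : Set V) (L0 : Set V)
        (fun i => (L i : Set V)) ∧ G.Adj v u) : Finset V) : Set V) := by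
      ext u; simp
    rw [hX, Set.ncard_coe_finset]
    refine H.part2 (v := v) ?_ _ (fun u hu => (Finset.mem_filter.1 hu).2.2) ?_
    · obtain ⟨h1, h2⟩ := hv
      push Not at h2
      rcases h1 with (h | h) | ⟨h3, h4, h5⟩
      · exact absurd h h2.1
      · exact Or.inl h
      · push Not at h4
        exact Or.inr ⟨h4.2, h5, h2.2 h3 h4⟩
    · intro u hu
      obtain ⟨huA, huY, -⟩ := Finset.mem_filter.1 hu
      rw [hY] at huY
      by_cases hu0 : u ∈ L0
      · exact Or.inl hu0
      right
      by_cases huL : ∃ i, u ∈ L i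
      · exact absurd ⟨Or.inl (Or.inr huL), fun h => h.elim hu0 (fun h => h.2.1 (Or.inr huL))⟩ huY
      have huV : ¬ (u ∈ L0 ∨ ∃ i, u ∈ L i) := fun h => h.elim hu0 huL
      have huL' : ∀ i, u ∉ L i := fun i h => huL ⟨i, h⟩
      by_cases hz : ∀ i, 4 * (nn G u (L i)).card ≤ G.cliqueNum ^ (s+2)
      · exact Or.inl ⟨huA, huL', hz⟩
      · refine Or.inr ⟨?_, huL'⟩
        intro i x hx hux
        exact huY ⟨Or.inr ⟨huA, huV, i, x, hx, hux⟩, fun h => h.elim hu0 (fun h => hz h.2.2)⟩
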